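/- For δ > 0, α = 1/log((1+δ)/δ), and the metric p(r,δ) = α/(r²+δ) on the unit disc, if δ < 1/(e^{(2m−1)π}−1) for a positive integer m, then the first m Dirichlet eigenvalues of the Laplace–Beltrami operator are simple and their eigenfunctions are S¹-invariant. -/

import Mathlib

open MeasureTheory Real Set Metric

/-- A Dirichlet eigenfunction of the Laplace–Beltrami operator of the conformal
    metric p(r,δ) ds², p(r,δ) = α/(r²+δ) with α = 1/log((1+δ)/δ), on the closed unit
    disc, with eigenvalue γ: in isothermic coordinates the equation reads
    Δu + γ p u = 0 on the open disc (Euclidean Δ), u = 0 on the boundary circle,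
    u nontrivial. The Laplacian is written as the sum of the two second directional
    derivatives along the coordinate axes. -/
def IsDirichletEigenfunction (δ γ : ℝ) (u : EuclideanSpace ℝ (Fin 2) → ℝ) : Prop :=
  ContinuousOn u (Metric.closedBall 0 1) ∧
  ContDiffOn ℝ 2 u (Metric.ball 0 1) ∧
  (∃ x ∈ Metric.ball (0 : EuclideanSpace ℝ (Fin 2)) 1, u x ≠ 0) ∧
  (∀ x ∈ Metric.sphere (0 : EuclideanSpace ℝ (Fin 2)) 1, u x = 0) ∧
  (∀ x ∈ Metric.ball (0 : EuclideanSpace ℝ (Fin 2)) 1,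
    (∑ i : Fin 2,
        deriv (deriv (fun t : ℝ => u (x + t • (EuclideanSpace.single i (1:ℝ))))) 0) +
      γ * ((1 / Real.log ((1 + δ) / δ)) / (‖x‖ ^ 2 + δ)) * u x = 0)

section PlaneLaplacian

open InnerProductSpace Laplacian Filter Topology

variable {E : Type*} [NormedAddCommGroup E] [InnerProductSpace ℝ E]

/-- The second derivative along a line is the diagonal of the second Fréchet derivative. -/
theorem iteratedFDeriv_two_diag_eq_deriv_deriv {u : E → ℝ} {x : E} (h : ContDiffAt ℝ 2 u x)
    (e : E) : iteratedFDeriv ℝ 2 u x ![e, e] = deriv (deriv fun t : ℝ => u (x + t • e)) 0 := by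
  have hline (t : ℝ) : HasDerivAt (fun t : ℝ => x + t • e) e t := by
    simpa using ((hasDerivAt_id t).smul_const e).const_add x
  have htend : Tendsto (fun t : ℝ => x + t • e) (𝓝 0) (𝓝 x) := by
    simpa using (hline 0).continuousAt.tendsto
  have hev : ∀ᶠ t : ℝ in 𝓝 0, DifferentiableAt ℝ u (x + t • e) :=
    htend.eventually ((h.eventually (by simp)).mono fun y hy => hy.differentiableAt (by simp))
  have hfirst : (deriv fun t : ℝ => u (x + t • e)) =ᶠ[𝓝 0] fun t => fderiv ℝ u (x + t • e) e :=
    hev.mono fun t ht => (ht.hasFDerivAt.comp_hasDerivAt t (hline t)).deriv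
  have hsecond : DifferentiableAt ℝ (fderiv ℝ u) (x + (0 : ℝ) • e) := by
    simpa using (h.fderiv_right (m := 1) (by norm_num)).differentiableAt (by simp)
  have hderiv : HasDerivAt (fun t : ℝ => fderiv ℝ u (x + t • e))
      (fderiv ℝ (fderiv ℝ u) (x + (0 : ℝ) • e) e) 0 :=
    hsecond.hasFDerivAt.comp_hasDerivAt (0 : ℝ) (hline 0)
  have happly := hderiv.clm_apply (hasDerivAt_const (0 : ℝ) e)
  rw [hfirst.deriv_eq, iteratedFDeriv_two_apply, happly.deriv]
  simp

/-- A twice differentiable function has nonpositive second derivative at a local maximum. -/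
theorem IsLocalMax.deriv_deriv_nonpos {f : ℝ → ℝ} {a : ℝ} (h : IsLocalMax f a)
    (hc : ContinuousAt f a) : deriv (deriv f) a ≤ 0 := by
  by_contra! hpos
  have hmin := isLocalMin_of_deriv_deriv_pos hpos h.deriv_eq_zero hc
  have hconst : f =ᶠ[𝓝 a] fun _ => f a := by
    filter_upwards [h, hmin] with t h₁ h₂ using le_antisymm h₁ h₂
  have := hconst.deriv.deriv_eq
  simp at this
  linarith

variable [FiniteDimensional ℝ E]

theorem IsLocalMax.laplacian_nonpos {u : E → ℝ} {x : E} (h : IsLocalMax u x)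
    (hu : ContDiffAt ℝ 2 u x) : Δ u x ≤ 0 := by
  rw [laplacian_eq_iteratedFDeriv_stdOrthonormalBasis]
  refine Finset.sum_nonpos fun i _ => ?_
  rw [iteratedFDeriv_two_diag_eq_deriv_deriv hu]
  set e := stdOrthonormalBasis ℝ E i
  have hcont : ContinuousAt (fun t : ℝ => x + t • e) 0 := by fun_prop
  have htend : Tendsto (fun t : ℝ => x + t • e) (𝓝 0) (𝓝 x) := by
    simpa using hcont.tendsto
  refine IsLocalMax.deriv_deriv_nonpos ?_ ?_
  · have := htend.eventually h
    simpa [IsLocalMax, IsMaxFilter] using this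
  · exact ContinuousAt.comp (f := fun t : ℝ => x + t • e) (by simpa using hu.continuousAt) hcont

/-- The Laplacian commutes with linear isometries. -/
theorem laplacian_comp_linearIsometryEquiv (A : E ≃ₗᵢ[ℝ] E) (u : E → ℝ) (x : E) :
    Δ (u ∘ A) x = Δ u (A x) := by
  rw [laplacian_eq_iteratedFDeriv_stdOrthonormalBasis,
    laplacian_eq_iteratedFDeriv_orthonormalBasis u ((stdOrthonormalBasis ℝ E).map A)]
  have hcomp := A.toContinuousLinearEquiv.iteratedFDerivWithin_comp_right u uniqueDiffOn_univ
    (mem_univ (A.toContinuousLinearEquiv x)) 2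
  simp only [preimage_univ, iteratedFDerivWithin_univ,
    LinearIsometryEquiv.coe_toContinuousLinearEquiv] at hcomp
  simp only [hcomp]
  refine Finset.sum_congr rfl fun i _ => ?_
  simp only [ContinuousMultilinearMap.compContinuousLinearMap_apply]
  congr 1
  ext j
  fin_cases j <;> simp

/-- A positive strict supersolution of `Δ + V` forces subsolutions that are nonpositive on the
boundary to be nonpositive. -/
theorem nonpos_of_strict_supersolution {K U : Set E} (hK : IsCompact K) (hU : IsOpen U)
    (hUK : U ⊆ K) {V w φ : E → ℝ} (hw : ContinuousOn w K) (hφ : ContinuousOn φ K)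
    (hφpos : ∀ x ∈ K, 0 < φ x) (hbdry : ∀ x ∈ K, x ∉ U → w x ≤ 0)
    (hw2 : ∀ x ∈ U, ContDiffAt ℝ 2 w x) (hφ2 : ∀ x ∈ U, ContDiffAt ℝ 2 φ x)
    (hwV : ∀ x ∈ U, 0 ≤ Δ w x + V x * w x) (hφV : ∀ x ∈ U, Δ φ x + V x * φ x < 0) :
    ∀ x ∈ K, w x ≤ 0 := by
  intro y hy
  by_contra! hwy
  obtain ⟨x, hxK, hx⟩ := hK.exists_isMaxOn ⟨y, hy⟩
    (hw.div hφ fun x hx => (hφpos x hx).ne')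
  set M := w x / φ x with hM
  have hMpos : 0 < M := (div_pos hwy (hφpos y hy)).trans_le (hx hy)
  have hxw : w x = M * φ x := by rw [hM, div_mul_cancel₀ _ (hφpos x hxK).ne']
  have hxU : x ∈ U := by
    by_contra hxU
    have := hbdry x hxK hxU
    have := mul_pos hMpos (hφpos x hxK)
    linarith
  have hmax : IsLocalMax (w - M • φ) x := by
    filter_upwards [hU.mem_nhds hxU] with z hz
    have h1 : w z / φ z ≤ M := hx (hUK hz)
    rw [div_le_iff₀ (hφpos z (hUK hz))] at h1
    simp only [Pi.sub_apply, Pi.smul_apply, smul_eq_mul]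
    linarith
  have hMφ : ContDiffAt ℝ 2 (M • φ) x := (hφ2 x hxU).const_smul M
  have hle := hmax.laplacian_nonpos ((hw2 x hxU).sub hMφ)
  rw [(hw2 x hxU).laplacian_sub hMφ, laplacian_smul M (hφ2 x hxU), smul_eq_mul] at hle
  have h1 := hwV x hxU
  have h2 := mul_neg_of_pos_of_neg hMpos (hφV x hxU)
  rw [hxw] at h1
  nlinarith

/-- The Laplacian in the plane, written with second derivatives along the coordinate axes. -/
theorem laplacian_eq_sum_deriv_deriv {u : EuclideanSpace ℝ (Fin 2) → ℝ}
    {x : EuclideanSpace ℝ (Fin 2)} (h : ContDiffAt ℝ 2 u x) :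
    Δ u x = ∑ i : Fin 2,
      deriv (deriv fun t : ℝ => u (x + t • EuclideanSpace.single i (1 : ℝ))) 0 := by
  rw [laplacian_eq_iteratedFDeriv_orthonormalBasis u (EuclideanSpace.basisFun (Fin 2) ℝ)]
  simp only [iteratedFDeriv_two_diag_eq_deriv_deriv h, EuclideanSpace.basisFun_apply]

end PlaneLaplacian

section Barrier

open InnerProductSpace Laplacian Filter Topology

theorem norm_add_smul_single_sq (x : EuclideanSpace ℝ (Fin 2)) (i : Fin 2) (t : ℝ) :
    ‖x + t • EuclideanSpace.single i (1 : ℝ)‖ ^ 2 = ‖x‖ ^ 2 + 2 * x i * t + t ^ 2 := by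
  rw [norm_add_sq_real, norm_smul, inner_smul_right, EuclideanSpace.inner_single_right]
  simp
  ring

theorem sum_sq_eq_norm_sq (x : EuclideanSpace ℝ (Fin 2)) : x 0 ^ 2 + x 1 ^ 2 = ‖x‖ ^ 2 := by
  rw [EuclideanSpace.norm_sq_eq, Fin.sum_univ_two]
  simp

/-- Second derivative at `0` of `S + c (1 - S ^ 2)` for `S = (a + b t) / √(ρ + 2 k t + t ^ 2)`. -/
theorem deriv_deriv_barrier_line (a b k ρ c : ℝ) (hQ : ∀ t : ℝ, 0 < ρ + 2 * k * t + t ^ 2) :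
    deriv (deriv fun t : ℝ => (a + b * t) / √(ρ + 2 * k * t + t ^ 2) +
      c * (1 - ((a + b * t) / √(ρ + 2 * k * t + t ^ 2)) ^ 2)) 0 =
    (-2 * b * k / √ρ ^ 3 - a / √ρ ^ 3 + 3 * a * k ^ 2 / √ρ ^ 5) * (1 - 2 * c * (a / √ρ)) -
      2 * c * (b / √ρ - a * k / √ρ ^ 3) ^ 2 := by
  set R : ℝ → ℝ := fun t => √(ρ + 2 * k * t + t ^ 2) with hR
  have hRpos (t : ℝ) : 0 < R t := Real.sqrt_pos.2 (hQ t)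
  have hR' (t : ℝ) : HasDerivAt R ((k + t) / R t) t := by
    have hquad : HasDerivAt (fun t : ℝ => ρ + 2 * k * t + t ^ 2) (2 * k + 2 * t) t := by
      refine ((((hasDerivAt_id t).const_mul (2 * k)).const_add ρ).add
        ((hasDerivAt_id t).pow 2)).congr_deriv ?_
      simp
    refine (hquad.sqrt (hQ t).ne').congr_deriv ?_
    rw [show 2 * k + 2 * t = 2 * (k + t) by ring, mul_div_mul_left _ _ two_ne_zero]
  have hlin (t : ℝ) : HasDerivAt (fun t : ℝ => a + b * t) b t := by
    simpa using ((hasDerivAt_id t).const_mul b).const_add a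
  have hkt (t : ℝ) : HasDerivAt (fun t : ℝ => k + t) 1 t := (hasDerivAt_id t).const_add k
  set S : ℝ → ℝ := fun t => (a + b * t) / R t with hS
  set S' : ℝ → ℝ := fun t => (b * R t - (a + b * t) * ((k + t) / R t)) / R t ^ 2 with hS'
  have hSd (t : ℝ) : HasDerivAt S (S' t) t := (hlin t).div (hR' t) (hRpos t).ne'
  have hfirst : (deriv fun t : ℝ => S t + c * (1 - S t ^ 2)) =
      fun t => S' t + c * (-(2 * S t * S' t)) := by
    funext t
    refine ((hSd t).add ((((hSd t).pow 2).const_sub 1).const_mul c)).deriv.trans ?_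
    simp
  have hS2 : HasDerivAt S' (-2 * b * k / √ρ ^ 3 - a / √ρ ^ 3 + 3 * a * k ^ 2 / √ρ ^ 5) 0 := by
    have h0 : R 0 = √ρ := by simp [hR]
    have hpos : √ρ ≠ 0 := h0 ▸ (hRpos 0).ne'
    refine ((((hR' 0).const_mul b).sub ((hlin 0).mul
      ((hkt 0).div (hR' 0) (hRpos 0).ne'))).div ((hR' 0).pow 2)
      (pow_pos (hRpos 0) 2).ne').congr_deriv ?_
    simp only [h0, Pi.div_apply, Pi.sub_apply, Pi.mul_apply, Pi.pow_apply]
    field_simp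
    ring
  have hsecond := hS2.add ((((hSd 0).const_mul 2).mul hS2).neg.const_mul c)
  have h0 : R 0 = √ρ := by simp [hR]
  have hpos : √ρ ≠ 0 := h0 ▸ (hRpos 0).ne'
  change deriv (deriv fun t : ℝ => S t + c * (1 - S t ^ 2)) 0 = _
  rw [hfirst]
  refine hsecond.deriv.trans ?_
  simp only [hS, hS', h0]
  field_simp
  ring

/-- A barrier on the half disc cut out by the direction `n`. -/
noncomputable def halfDiscBarrier (δ c : ℝ) (n z : EuclideanSpace ℝ (Fin 2)) : ℝ :=
  inner ℝ n z / √(δ + ‖z‖ ^ 2) + c * (1 - (inner ℝ n z / √(δ + ‖z‖ ^ 2)) ^ 2)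

variable {δ c : ℝ} {n : EuclideanSpace ℝ (Fin 2)}

theorem contDiff_halfDiscBarrier (hδ : 0 < δ) : ContDiff ℝ 2 (halfDiscBarrier δ c n) := by
  have h : ContDiff ℝ 2 fun z : EuclideanSpace ℝ (Fin 2) => inner ℝ n z / √(δ + ‖z‖ ^ 2) := by
    have hQ (z : EuclideanSpace ℝ (Fin 2)) : 0 < δ + ‖z‖ ^ 2 := by positivity
    refine ContDiff.div (contDiff_const.inner ℝ contDiff_id)
      (ContDiff.sqrt (contDiff_const.add (contDiff_norm_sq ℝ)) fun z => (hQ z).ne')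
      fun z => (Real.sqrt_pos.2 (hQ z)).ne'
  exact h.add (contDiff_const.mul (contDiff_const.sub (h.pow 2)))

theorem laplacian_halfDiscBarrier (hδ : 0 < δ) (hn : ‖n‖ = 1) (z : EuclideanSpace ℝ (Fin 2)) :
    Δ (halfDiscBarrier δ c n) z =
      (-(inner ℝ n z / √(δ + ‖z‖ ^ 2)) * (1 + 3 * (δ / (δ + ‖z‖ ^ 2))) *
          (1 - 2 * c * (inner ℝ n z / √(δ + ‖z‖ ^ 2))) -
        2 * c * (1 - (inner ℝ n z / √(δ + ‖z‖ ^ 2)) ^ 2 * (1 + δ / (δ + ‖z‖ ^ 2)))) /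
      (δ + ‖z‖ ^ 2) := by
  rw [laplacian_eq_sum_deriv_deriv (contDiff_halfDiscBarrier hδ).contDiffAt]
  have hline (i : Fin 2) : (fun t : ℝ =>
      halfDiscBarrier δ c n (z + t • EuclideanSpace.single i (1 : ℝ))) = fun t : ℝ =>
      (inner ℝ n z + n i * t) / √((δ + ‖z‖ ^ 2) + 2 * z i * t + t ^ 2) +
      c * (1 - ((inner ℝ n z + n i * t) / √((δ + ‖z‖ ^ 2) + 2 * z i * t + t ^ 2)) ^ 2) := by
    funext t
    have h1 : inner ℝ n (z + t • EuclideanSpace.single i (1 : ℝ)) = inner ℝ n z + n i * t := by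
      rw [inner_add_right, inner_smul_right, EuclideanSpace.inner_single_right]
      simp [mul_comm]
    have h2 : δ + ‖z + t • EuclideanSpace.single i (1 : ℝ)‖ ^ 2 =
        δ + ‖z‖ ^ 2 + 2 * z i * t + t ^ 2 := by rw [norm_add_smul_single_sq]; ring
    rw [halfDiscBarrier, h1, h2]
  have hQ (i : Fin 2) (t : ℝ) : 0 < δ + ‖z‖ ^ 2 + 2 * z i * t + t ^ 2 := by
    have := norm_add_smul_single_sq z i t
    nlinarith [sq_nonneg ‖z + t • EuclideanSpace.single i (1 : ℝ)‖]
  simp only [hline, Fin.sum_univ_two, deriv_deriv_barrier_line _ _ _ _ _ (hQ _)]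
  have hinner : inner ℝ n z = n 0 * z 0 + n 1 * z 1 := by
    rw [PiLp.inner_apply, Fin.sum_univ_two]
    simp [mul_comm]
  have hn2 : n 0 ^ 2 + n 1 ^ 2 = 1 := by rw [sum_sq_eq_norm_sq, hn, one_pow]
  have hz2 := sum_sq_eq_norm_sq z
  have hρ : 0 < δ + ‖z‖ ^ 2 := by positivity
  have hsq : √(δ + ‖z‖ ^ 2) ^ 2 = δ + ‖z‖ ^ 2 := Real.sq_sqrt hρ.le
  have hrpos : 0 < √(δ + ‖z‖ ^ 2) := Real.sqrt_pos.2 hρ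
  set r := √(δ + ‖z‖ ^ 2)
  set a := inner ℝ n z
  have hδr : δ = r ^ 2 - (z 0 ^ 2 + z 1 ^ 2) := by rw [hsq, hz2]; ring
  rw [← hsq, hδr]
  have hz0 : ‖z‖ ^ 2 = z 0 ^ 2 + z 1 ^ 2 := hz2.symm
  have hgrad : (n 0 / r - a * z 0 / r ^ 3) ^ 2 + (n 1 / r - a * z 1 / r ^ 3) ^ 2 =
      1 / r ^ 2 - 2 * a ^ 2 / r ^ 4 + a ^ 2 * (z 0 ^ 2 + z 1 ^ 2) / r ^ 6 := by
    have : (n 0 / r - a * z 0 / r ^ 3) ^ 2 + (n 1 / r - a * z 1 / r ^ 3) ^ 2 =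
      (n 0 ^ 2 + n 1 ^ 2) / r ^ 2 - 2 * a * (n 0 * z 0 + n 1 * z 1) / r ^ 4 +
        a ^ 2 * (z 0 ^ 2 + z 1 ^ 2) / r ^ 6 := by field_simp; ring
    rw [this, hn2, ← hinner]
    ring
  have hlap : (-2 * n 0 * z 0 / r ^ 3 - a / r ^ 3 + 3 * a * z 0 ^ 2 / r ^ 5) +
      (-2 * n 1 * z 1 / r ^ 3 - a / r ^ 3 + 3 * a * z 1 ^ 2 / r ^ 5) =
      -4 * a / r ^ 3 + 3 * a * (z 0 ^ 2 + z 1 ^ 2) / r ^ 5 := by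
    have : (-2 * n 0 * z 0 / r ^ 3 - a / r ^ 3 + 3 * a * z 0 ^ 2 / r ^ 5) +
      (-2 * n 1 * z 1 / r ^ 3 - a / r ^ 3 + 3 * a * z 1 ^ 2 / r ^ 5) =
      (-2 * (n 0 * z 0 + n 1 * z 1) - 2 * a) / r ^ 3 +
        3 * a * (z 0 ^ 2 + z 1 ^ 2) / r ^ 5 := by field_simp; ring
    rw [this, ← hinner]
    ring
  calc _ = ((-2 * n 0 * z 0 / r ^ 3 - a / r ^ 3 + 3 * a * z 0 ^ 2 / r ^ 5) +
      (-2 * n 1 * z 1 / r ^ 3 - a / r ^ 3 + 3 * a * z 1 ^ 2 / r ^ 5)) * (1 - 2 * c * (a / r)) -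
      2 * c * ((n 0 / r - a * z 0 / r ^ 3) ^ 2 + (n 1 / r - a * z 1 / r ^ 3) ^ 2) := by ring
    _ = _ := by
      rw [hgrad, hlap]
      field_simp
      ring

theorem div_sqrt_add_norm_sq_lt_one (hδ : 0 < δ) (hn : ‖n‖ = 1) (z : EuclideanSpace ℝ (Fin 2)) :
    inner ℝ n z / √(δ + ‖z‖ ^ 2) < 1 := by
  have hρ : 0 < δ + ‖z‖ ^ 2 := by positivity
  rw [div_lt_one (Real.sqrt_pos.2 hρ)]
  refine Real.lt_sqrt_of_sq_lt ?_
  have := abs_real_inner_le_norm n z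
  rw [hn, one_mul] at this
  have := sq_le_sq' (neg_le_of_abs_le this) (le_of_abs_le this)
  linarith

theorem halfDiscBarrier_pos (hδ : 0 < δ) (hc : 0 < c) (hn : ‖n‖ = 1)
    {z : EuclideanSpace ℝ (Fin 2)} (hz : 0 ≤ inner ℝ n z) : 0 < halfDiscBarrier δ c n z := by
  have h1 := div_sqrt_add_norm_sq_lt_one hδ hn z
  have h0 : 0 ≤ inner ℝ n z / √(δ + ‖z‖ ^ 2) := by positivity
  rw [halfDiscBarrier]
  have : 0 < 1 - (inner ℝ n z / √(δ + ‖z‖ ^ 2)) ^ 2 := by nlinarith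
  positivity

theorem halfDiscBarrier_supersolution {μ : ℝ} (hδ : 0 < δ) (hμ : 0 < μ) (hc : 0 < c)
    (hcμ : 2 * c < 1 - μ) (hc' : c ≤ 3 / 8) (hn : ‖n‖ = 1)
    {z : EuclideanSpace ℝ (Fin 2)} (hz : 0 ≤ inner ℝ n z) :
    Δ (halfDiscBarrier δ c n) z + μ / (‖z‖ ^ 2 + δ) * halfDiscBarrier δ c n z < 0 := by
  have h1 := div_sqrt_add_norm_sq_lt_one hδ hn z
  have h0 : 0 ≤ inner ℝ n z / √(δ + ‖z‖ ^ 2) := by positivity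
  rw [laplacian_halfDiscBarrier hδ hn, halfDiscBarrier, add_comm (‖z‖ ^ 2) δ]
  have hρ : 0 < δ + ‖z‖ ^ 2 := by positivity
  have hτ : 0 < δ / (δ + ‖z‖ ^ 2) := by positivity
  set s := inner ℝ n z / √(δ + ‖z‖ ^ 2)
  set τ := δ / (δ + ‖z‖ ^ 2)
  rw [div_mul_eq_mul_div, ← add_div]
  refine div_neg_of_neg_of_pos ?_ hρ
  have hmain : 0 < (1 - μ) * s + c * (2 - μ) - c * (4 - μ) * s ^ 2 := by
    have h2 : 0 < (1 - s) * (c * (2 - μ)) := mul_pos (by linarith) (mul_pos hc (by linarith))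
    have h3 : 0 ≤ s * (1 - μ - 2 * c) := mul_nonneg h0 (by linarith)
    have h4 : 0 ≤ c * (4 - μ) * (s * (1 - s)) :=
      mul_nonneg (mul_nonneg hc.le (by linarith)) (mul_nonneg h0 (by linarith))
    nlinarith
  have hrest : 0 ≤ τ * s * (3 - 8 * c * s) := by
    refine mul_nonneg (mul_nonneg hτ.le h0) ?_
    nlinarith [mul_le_mul hc' h1.le h0 (by norm_num)]
  nlinarith

end Barrier

section DiscSolutions

open InnerProductSpace Laplacian Filter Topology

/-- Classical solutions of `Δ u + μ / (‖x‖ ^ 2 + δ) u = 0` on the open unit disc. -/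
def IsDiscSolution (δ μ : ℝ) (u : EuclideanSpace ℝ (Fin 2) → ℝ) : Prop :=
  ContDiffOn ℝ 2 u (ball 0 1) ∧
    ∀ x ∈ ball (0 : EuclideanSpace ℝ (Fin 2)) 1, Δ u x + μ / (‖x‖ ^ 2 + δ) * u x = 0

variable {δ μ : ℝ} {u v : EuclideanSpace ℝ (Fin 2) → ℝ}

theorem IsDiscSolution.contDiffAt (hu : IsDiscSolution δ μ u) {x : EuclideanSpace ℝ (Fin 2)}
    (hx : x ∈ ball (0 : EuclideanSpace ℝ (Fin 2)) 1) : ContDiffAt ℝ 2 u x :=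
  hu.1.contDiffAt (isOpen_ball.mem_nhds hx)

theorem isDirichletEigenfunction_iff {γ : ℝ} : IsDirichletEigenfunction δ γ u ↔
    ContinuousOn u (closedBall 0 1) ∧ IsDiscSolution δ (γ / Real.log ((1 + δ) / δ)) u ∧
      (∃ x ∈ ball (0 : EuclideanSpace ℝ (Fin 2)) 1, u x ≠ 0) ∧
      ∀ x ∈ sphere (0 : EuclideanSpace ℝ (Fin 2)) 1, u x = 0 := by
  have hcoeff (x : EuclideanSpace ℝ (Fin 2)) :
      γ * ((1 / Real.log ((1 + δ) / δ)) / (‖x‖ ^ 2 + δ)) =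
        γ / Real.log ((1 + δ) / δ) / (‖x‖ ^ 2 + δ) := by ring
  have hiff (h2 : ContDiffOn ℝ 2 u (ball 0 1)) :
      (∀ x ∈ ball (0 : EuclideanSpace ℝ (Fin 2)) 1,
        (∑ i : Fin 2,
          deriv (deriv (fun t : ℝ => u (x + t • (EuclideanSpace.single i (1:ℝ))))) 0) +
        γ * ((1 / Real.log ((1 + δ) / δ)) / (‖x‖ ^ 2 + δ)) * u x = 0) ↔
      ∀ x ∈ ball (0 : EuclideanSpace ℝ (Fin 2)) 1,
        Δ u x + γ / Real.log ((1 + δ) / δ) / (‖x‖ ^ 2 + δ) * u x = 0 := by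
    refine forall₂_congr fun x hx => ?_
    rw [laplacian_eq_sum_deriv_deriv (h2.contDiffAt (isOpen_ball.mem_nhds hx)), hcoeff]
  constructor
  · rintro ⟨h1, h2, h3, h4, h5⟩
    exact ⟨h1, ⟨h2, (hiff h2).1 h5⟩, h3, h4⟩
  · rintro ⟨h1, ⟨h2, h5⟩, h3, h4⟩
    exact ⟨h1, h2, h3, h4, (hiff h2).2 h5⟩

theorem IsDiscSolution.sub (hu : IsDiscSolution δ μ u) (hv : IsDiscSolution δ μ v) :
    IsDiscSolution δ μ (u - v) := by
  refine ⟨hu.1.sub hv.1, fun x hx => ?_⟩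
  rw [(hu.contDiffAt hx).laplacian_sub (hv.contDiffAt hx), Pi.sub_apply]
  linear_combination hu.2 x hx - hv.2 x hx

theorem IsDiscSolution.const_smul (hu : IsDiscSolution δ μ u) (a : ℝ) :
    IsDiscSolution δ μ (a • u) := by
  refine ⟨hu.1.const_smul a, fun x hx => ?_⟩
  rw [laplacian_smul a (hu.contDiffAt hx), Pi.smul_apply, smul_eq_mul, smul_eq_mul]
  linear_combination a * hu.2 x hx

theorem IsDiscSolution.comp_linearIsometryEquiv (hu : IsDiscSolution δ μ u)
    (A : EuclideanSpace ℝ (Fin 2) ≃ₗᵢ[ℝ] EuclideanSpace ℝ (Fin 2)) :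
    IsDiscSolution δ μ (u ∘ A) := by
  have hA : MapsTo A (ball 0 1) (ball 0 1) := fun x hx => by simpa using hx
  refine ⟨hu.1.comp A.toContinuousLinearEquiv.contDiff.contDiffOn hA, fun x hx => ?_⟩
  rw [laplacian_comp_linearIsometryEquiv]
  simpa using hu.2 (A x) (hA hx)

/-- Below the threshold `1`, a solution with zero boundary values is invariant under rotations. -/
theorem IsDiscSolution.le_of_norm_eq (hδ : 0 < δ) (hμ : 0 < μ) (hμ1 : μ < 1)
    (hu : IsDiscSolution δ μ u) (hc : ContinuousOn u (closedBall 0 1))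
    (hbdry : ∀ x ∈ sphere (0 : EuclideanSpace ℝ (Fin 2)) 1, u x = 0)
    {x y : EuclideanSpace ℝ (Fin 2)} (hx : x ∈ closedBall (0 : EuclideanSpace ℝ (Fin 2)) 1)
    (hxy : ‖x‖ = ‖y‖) : u x ≤ u y := by
  rcases eq_or_ne x y with rfl | hne
  · exact le_rfl
  have hd : 0 < ‖x - y‖ := norm_pos_iff.2 (sub_ne_zero.2 hne)
  set n : EuclideanSpace ℝ (Fin 2) := ‖x - y‖⁻¹ • (x - y) with hn_def
  have hn : ‖n‖ = 1 := by
    rw [hn_def, norm_smul, norm_inv, norm_norm, inv_mul_cancel₀ hd.ne']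
  set R := (Submodule.span ℝ {x - y})ᗮ.reflection with hR
  have hcR : ContinuousOn (u ∘ R) (closedBall 0 1) :=
    hc.comp R.continuous.continuousOn fun z hz => by simpa using hz
  obtain ⟨c, hc0, hcμ, hc8⟩ : ∃ c : ℝ, 0 < c ∧ 2 * c < 1 - μ ∧ c ≤ 3 / 8 :=
    ⟨(1 - μ) / 4, by linarith, by linarith, by linarith⟩
  have hinner : Continuous fun z : EuclideanSpace ℝ (Fin 2) => inner ℝ n z := by fun_prop
  have hw := hu.sub (hu.comp_linearIsometryEquiv R)
  have key := nonpos_of_strict_supersolution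
    (K := closedBall 0 1 ∩ {z : EuclideanSpace ℝ (Fin 2) | 0 ≤ inner ℝ n z})
    (U := ball 0 1 ∩ {z : EuclideanSpace ℝ (Fin 2) | 0 < inner ℝ n z})
    (V := fun z => μ / (‖z‖ ^ 2 + δ)) (w := u - u ∘ R) (φ := halfDiscBarrier δ c n)
    ((isCompact_closedBall _ _).inter_right (isClosed_le continuous_const hinner))
    (isOpen_ball.inter (isOpen_lt continuous_const hinner))
    (inter_subset_inter ball_subset_closedBall fun z (hz : 0 < inner ℝ n z) => hz.le)
    ((hc.sub hcR).mono inter_subset_left)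
    (contDiff_halfDiscBarrier hδ).continuous.continuousOn
    (fun z hz => halfDiscBarrier_pos hδ hc0 hn hz.2) ?_
    (fun z hz => hw.contDiffAt hz.1)
    (fun z _ => (contDiff_halfDiscBarrier hδ).contDiffAt)
    (fun z hz => (hw.2 z hz.1).ge)
    (fun z hz => halfDiscBarrier_supersolution hδ hμ hc0 hcμ hc8 hn hz.2.le)
    x ⟨hx, ?_⟩
  · have hRx : R x = y := Submodule.reflection_sub hxy
    simpa [hRx] using key
  · rintro z ⟨hz1, hz2⟩ hzU
    rcases (mem_closedBall_zero_iff.1 hz1).lt_or_eq with hlt | heq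
    · have h0 : inner ℝ n z = 0 := by
        refine le_antisymm (not_lt.1 fun h => hzU ⟨mem_ball_zero_iff.2 hlt, h⟩) hz2
      have hzR : R z = z := by
        refine Submodule.reflection_mem_subspace_eq_self ?_
        rw [Submodule.mem_orthogonal_singleton_iff_inner_right]
        rw [hn_def, inner_smul_left] at h0
        simpa [hd.ne'] using h0
      simp [hzR]
    · have h1 := hbdry z (mem_sphere_zero_iff_norm.2 heq)
      have h2 := hbdry (R z) (mem_sphere_zero_iff_norm.2 (by rw [R.norm_map, heq]))
      simp [h1, h2]
  · change 0 ≤ inner ℝ n x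
    rw [hn_def, real_inner_smul_left, inner_sub_left, real_inner_self_eq_norm_sq]
    have := real_inner_le_norm y x
    have : 0 ≤ ‖x‖ ^ 2 - inner ℝ y x := by rw [hxy] at this ⊢; nlinarith
    positivity

/-- For a nonpositive parameter, solutions with zero boundary values are nonpositive. -/
theorem IsDiscSolution.nonpos_of_nonpos (hδ : 0 < δ) (hμ : μ ≤ 0)
    (hu : IsDiscSolution δ μ u) (hc : ContinuousOn u (closedBall 0 1))
    (hbdry : ∀ x ∈ sphere (0 : EuclideanSpace ℝ (Fin 2)) 1, u x = 0)
    {x : EuclideanSpace ℝ (Fin 2)} (hx : x ∈ closedBall (0 : EuclideanSpace ℝ (Fin 2)) 1) :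
    u x ≤ 0 := by
  have hφ : ContDiff ℝ 2 fun z : EuclideanSpace ℝ (Fin 2) => 2 - ‖z‖ ^ 2 :=
    contDiff_const.sub (contDiff_norm_sq ℝ)
  have hlap (z : EuclideanSpace ℝ (Fin 2)) : 
      Δ (fun y : EuclideanSpace ℝ (Fin 2) => 2 - ‖y‖ ^ 2 : EuclideanSpace ℝ (Fin 2) → ℝ) z = -4 := by
    rw [laplacian_eq_sum_deriv_deriv hφ.contDiffAt]
    have hline (i : Fin 2) :
        deriv (deriv fun t : ℝ => 2 - ‖z + t • EuclideanSpace.single i (1 : ℝ)‖ ^ 2) 0 = -2 := by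
      have hfirst (t : ℝ) : HasDerivAt (fun t : ℝ =>
          2 - ‖z + t • EuclideanSpace.single i (1 : ℝ)‖ ^ 2) (-(2 * z i + 2 * t)) t := by
        simp only [norm_add_smul_single_sq]
        refine (((((hasDerivAt_id t).const_mul (2 * z i)).const_add (‖z‖ ^ 2)).add
          ((hasDerivAt_id t).pow 2)).const_sub 2).congr_deriv ?_
        simp
      rw [funext fun t => (hfirst t).deriv]
      refine ((((hasDerivAt_id (0 : ℝ)).const_mul 2).const_add (2 * z i)).neg).deriv.trans ?_
      simp
    simp only [hline, Finset.sum_const, Finset.card_univ, Fintype.card_fin]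
    norm_num
  have hpos : ∀ z ∈ closedBall (0 : EuclideanSpace ℝ (Fin 2)) 1, 0 < 2 - ‖z‖ ^ 2 := by
    intro z hz
    have := mem_closedBall_zero_iff.1 hz
    nlinarith [norm_nonneg z]
  refine nonpos_of_strict_supersolution (V := fun z => μ / (‖z‖ ^ 2 + δ))
    (isCompact_closedBall (0 : EuclideanSpace ℝ (Fin 2)) 1) isOpen_ball ball_subset_closedBall hc
    hφ.continuous.continuousOn hpos ?_ (fun z hz => hu.contDiffAt hz)
    (fun z _ => hφ.contDiffAt) (fun z hz => (hu.2 z hz).ge) ?_ x hx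
  · intro z hz hzU
    refine (hbdry z (mem_sphere_zero_iff_norm.2 ?_)).le
    exact le_antisymm (mem_closedBall_zero_iff.1 hz) (not_lt.1 fun h => hzU (by simpa using h))
  · intro z hz
    rw [hlap]
    have h1 := hpos z (ball_subset_closedBall hz)
    have h2 : μ / (‖z‖ ^ 2 + δ) ≤ 0 := div_nonpos_of_nonpos_of_nonneg hμ (by positivity)
    nlinarith [mul_nonneg (neg_nonneg.2 h2) h1.le]

/-- A rotation invariant solution that vanishes at the centre vanishes identically. -/
theorem IsDiscSolution.eq_zero_of_radial (hδ : 0 < δ) (hμ : 0 < μ)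
    (hu : IsDiscSolution δ μ u)
    (hrad : ∀ x ∈ ball (0 : EuclideanSpace ℝ (Fin 2)) 1, ∀ y, ‖x‖ = ‖y‖ → u x = u y)
    (h0 : u 0 = 0) : ∀ x ∈ ball (0 : EuclideanSpace ℝ (Fin 2)) 1, u x = 0 := by
  set e : EuclideanSpace ℝ (Fin 2) := EuclideanSpace.single 0 1 with he
  set f : ℝ → ℝ := fun r => u (r • e) with hf
  have hnorm (r : ℝ) : ‖r • e‖ = |r| := by simp [he, norm_smul]
  have hmem {r : ℝ} (hr : r ∈ Ioo (-1 : ℝ) 1) : r • e ∈ ball (0 : EuclideanSpace ℝ (Fin 2)) 1 := by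
    rw [mem_ball_zero_iff, hnorm]
    exact abs_lt.2 hr
  have hf2 : ContDiffOn ℝ 2 f (Ioo (-1) 1) :=
    hu.1.comp (contDiff_id.smul contDiff_const).contDiffOn fun r hr => hmem hr
  have hf1 : ContDiffOn ℝ 1 (deriv f) (Ioo (-1) 1) :=
    ((contDiffOn_succ_iff_deriv_of_isOpen (n := 1) isOpen_Ioo).1 hf2).2.2
  have hdf {r : ℝ} (hr : r ∈ Ioo (-1 : ℝ) 1) : HasDerivAt f (deriv f r) r :=
    ((hf2.differentiableOn (by simp)).differentiableAt (isOpen_Ioo.mem_nhds hr)).hasDerivAt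
  have hddf {r : ℝ} (hr : r ∈ Ioo (-1 : ℝ) 1) : HasDerivAt (deriv f) (deriv (deriv f) r) r :=
    ((hf1.differentiableOn (by simp)).differentiableAt (isOpen_Ioo.mem_nhds hr)).hasDerivAt
  have hode {r : ℝ} (hr : r ∈ Ioo (0 : ℝ) 1) :
      deriv (deriv f) r + deriv f r / r + μ / (r ^ 2 + δ) * f r = 0 := by
    have hr' : r ∈ Ioo (-1 : ℝ) 1 := ⟨by linarith [hr.1], hr.2⟩
    have heq := hu.2 _ (hmem hr')
    rw [laplacian_eq_sum_deriv_deriv (hu.contDiffAt (hmem hr')), Fin.sum_univ_two, hnorm,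
      sq_abs] at heq
    have hax : deriv (deriv fun t : ℝ => u (r • e + t • EuclideanSpace.single 0 (1 : ℝ))) 0 =
        deriv (deriv f) r := by
      have : (fun t : ℝ => u (r • e + t • EuclideanSpace.single 0 (1 : ℝ))) =
          fun t => f (r + t) := by
        funext t
        rw [hf, ← he]
        simp only [add_smul]
      rw [this, funext fun t => deriv_comp_const_add f r t, deriv_comp_const_add, add_zero]
    have htr : deriv (deriv fun t : ℝ => u (r • e + t • EuclideanSpace.single 1 (1 : ℝ))) 0 =
        deriv f r / r := by
      have hsq (t : ℝ) : ‖r • e + t • EuclideanSpace.single 1 (1 : ℝ)‖ ^ 2 = r ^ 2 + t ^ 2 := by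
        rw [norm_add_smul_single_sq, hnorm, sq_abs]
        simp [he]
      have hpos (t : ℝ) : 0 < r ^ 2 + t ^ 2 := by have := hr.1; positivity
      set ρ : ℝ → ℝ := fun t => √(r ^ 2 + t ^ 2) with hρ
      have hρ0 : ρ 0 = r := by simp [hρ, Real.sqrt_sq hr.1.le]
      have hρpos (t : ℝ) : 0 < ρ t := Real.sqrt_pos.2 (hpos t)
      have hρd (t : ℝ) : HasDerivAt ρ (t / ρ t) t := by
        refine ((((hasDerivAt_id t).pow 2).const_add (r ^ 2)).sqrt (hpos t).ne').congr_deriv ?_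
        simp only [id, hρ]
        rw [Nat.cast_ofNat, pow_one, mul_one, mul_div_mul_left _ _ two_ne_zero]
        simp
      have hev : ∀ᶠ t in 𝓝 (0 : ℝ), ρ t ∈ Ioo (-1 : ℝ) 1 :=
        (hρd 0).continuousAt.eventually_mem (isOpen_Ioo.mem_nhds (by rwa [hρ0]))
      have hcomp : (fun t : ℝ => u (r • e + t • EuclideanSpace.single 1 (1 : ℝ))) =ᶠ[𝓝 0]
          fun t => f (ρ t) := by
        filter_upwards [hev] with t ht
        refine (hrad _ (hmem ht) _ ?_).symm
        rw [hnorm, abs_of_pos (hρpos t), ← sq_eq_sq₀ (hρpos t).le (norm_nonneg _), hsq,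
          Real.sq_sqrt (hpos t).le]
      have hcomp' : (deriv fun t => f (ρ t)) =ᶠ[𝓝 0] fun t => deriv f (ρ t) * (t / ρ t) := by
        filter_upwards [hev] with t ht using ((hdf ht).comp t (hρd t)).deriv
      rw [hcomp.deriv.deriv_eq, hcomp'.deriv_eq]
      have h1 : HasDerivAt (fun t => deriv f (ρ t)) (deriv (deriv f) (ρ 0) * (0 / ρ 0)) 0 :=
        (hddf (by rwa [hρ0])).comp (0 : ℝ) (hρd 0)
      have h2 := h1.mul ((hasDerivAt_id (0 : ℝ)).div (hρd 0) (hρpos 0).ne')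
      refine h2.deriv.trans ?_
      have := hr.1.ne'
      simp only [hρ0, Pi.div_apply, id]
      field_simp
      ring
    rw [hax, htr] at heq
    exact heq
  have heven : deriv f 0 = 0 := by
    have hfe : (fun r => f (-r)) =ᶠ[𝓝 0] f := by
      filter_upwards [isOpen_Ioo.mem_nhds (show (0 : ℝ) ∈ Ioo (-1 : ℝ) 1 by simp)] with r hr
      exact hrad _ (hmem ⟨by linarith [hr.2], by linarith [hr.1]⟩) _ (by simp [hnorm])
    have := hfe.deriv_eq
    rw [deriv_comp_neg, neg_zero] at this
    linarith
  set V : ℝ → ℝ := fun r => μ / (r ^ 2 + δ) with hV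
  have hVpos (r : ℝ) : 0 < V r := div_pos hμ (by positivity)
  have hVd (r : ℝ) : HasDerivAt V (-(μ * (2 * r)) / (r ^ 2 + δ) ^ 2) r := by
    have hden : HasDerivAt (fun r : ℝ => r ^ 2 + δ) (2 * r) r := by
      refine (((hasDerivAt_id r).pow 2).add_const δ).congr_deriv ?_
      simp
    refine ((hasDerivAt_const r μ).div hden (by positivity)).congr_deriv ?_
    ring
  set H : ℝ → ℝ := fun r => deriv f r ^ 2 + V r * f r ^ 2 with hH
  have hHd {r : ℝ} (hr : r ∈ Ioo (-1 : ℝ) 1) : HasDerivAt H (2 * deriv f r * deriv (deriv f) r +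
      (-(μ * (2 * r)) / (r ^ 2 + δ) ^ 2 * f r ^ 2 + V r * (2 * f r * deriv f r))) r := by
    refine (((hddf hr).pow 2).add ((hVd r).mul ((hdf hr).pow 2))).congr_deriv ?_
    simp
  have hanti : AntitoneOn H (Ico 0 1) := by
    have hsub {r : ℝ} (hr : r ∈ Ico (0 : ℝ) 1) : r ∈ Ioo (-1 : ℝ) 1 := ⟨by linarith [hr.1], hr.2⟩
    refine antitoneOn_of_deriv_nonpos (convex_Ico 0 1)
      (fun r hr => (hHd (hsub hr)).continuousAt.continuousWithinAt)
      (fun r hr => (hHd (hsub (interior_subset hr))).differentiableAt.differentiableWithinAt) ?_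
    intro r hr
    rw [(hHd (hsub (interior_subset hr))).deriv]
    rw [interior_Ico] at hr
    have h1 := hode hr
    have h2 : 0 ≤ μ * (2 * r) / (r ^ 2 + δ) ^ 2 * f r ^ 2 := by have := hr.1; positivity
    have h3 : 0 ≤ 2 * deriv f r ^ 2 / r := by have := hr.1; positivity
    have h4 : deriv (deriv f) r = -(deriv f r / r) - V r * f r := by
      simp only [hV]
      linarith
    rw [h4]
    have h5 : 2 * deriv f r * (-(deriv f r / r) - V r * f r) +
      (-(μ * (2 * r)) / (r ^ 2 + δ) ^ 2 * f r ^ 2 + V r * (2 * f r * deriv f r)) =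
      -(2 * deriv f r ^ 2 / r) - μ * (2 * r) / (r ^ 2 + δ) ^ 2 * f r ^ 2 := by ring
    rw [h5]
    linarith
  intro x hx
  have hx1 : ‖x‖ ∈ Ico (0 : ℝ) 1 := ⟨norm_nonneg x, mem_ball_zero_iff.1 hx⟩
  have hle := hanti (left_mem_Ico.2 one_pos) hx1 hx1.1
  have hf0 : f 0 = 0 := by simpa [hf] using h0
  simp only [hH, heven, hf0] at hle
  have hfx : f ‖x‖ = 0 := by
    have h1 := mul_nonneg (hVpos ‖x‖).le (sq_nonneg (f ‖x‖))
    have h2 : V ‖x‖ * f ‖x‖ ^ 2 = 0 := by nlinarith [sq_nonneg (deriv f ‖x‖)]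
    rcases mul_eq_zero.1 h2 with h | h
    · exact absurd h (hVpos _).ne'
    · exact pow_eq_zero_iff two_ne_zero |>.1 h
  rw [hrad x hx (‖x‖ • e) (by rw [hnorm, abs_norm])]
  exact hfx

end DiscSolutions

section PowerSeries

open Filter Topology

variable {a : ℕ → ℝ}

theorem summable_mul_pow_of_linear_bound (ha : ∀ n, |a n| ≤ n + 1) {z : ℝ} (hz : |z| < 1) :
    Summable fun n => a n * z ^ n := by
  have hgeom : Summable fun n : ℕ => ((n : ℝ) + 1) * |z| ^ n := by
    have h1 := summable_pow_mul_geometric_of_norm_lt_one 1 (r := |z|) (by simpa using hz)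
    have h0 := summable_geometric_of_lt_one (abs_nonneg z) hz
    refine (h1.add h0).congr fun n => ?_
    ring
  refine Summable.of_norm_bounded hgeom fun n => ?_
  rw [norm_mul, norm_pow, Real.norm_eq_abs, Real.norm_eq_abs]
  exact mul_le_mul_of_nonneg_right (ha n) (by positivity)

theorem hasDerivAt_tsum_mul_pow (ha : ∀ n, |a n| ≤ n + 1) {z : ℝ} (hz : |z| < 1) :
    HasDerivAt (fun z => ∑' n, a n * z ^ n) (∑' n : ℕ, (n + 1) * a (n + 1) * z ^ n) z := by
  obtain ⟨ρ, hzρ, hρ⟩ := exists_between hz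
  have hρ0 : 0 < ρ := (abs_nonneg z).trans_lt hzρ
  have hsum : Summable fun n : ℕ => ((n : ℝ) + 1) * (n * ρ ^ (n - 1)) := by
    rw [← summable_nat_add_iff 1]
    have hnorm : ‖ρ‖ < 1 := by rwa [Real.norm_eq_abs, abs_of_pos hρ0]
    have h2 := summable_pow_mul_geometric_of_norm_lt_one 2 hnorm
    have h1 := (summable_pow_mul_geometric_of_norm_lt_one 1 hnorm).mul_left 3
    have h0 := (summable_geometric_of_lt_one hρ0.le hρ).mul_left 2
    refine ((h2.add h1).add h0).congr fun n => ?_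
    push_cast
    ring
  have hbound (n : ℕ) (y : ℝ) (hy : y ∈ ball (0 : ℝ) ρ) :
      ‖a n * (n * y ^ (n - 1))‖ ≤ ((n : ℝ) + 1) * (n * ρ ^ (n - 1)) := by
    rw [norm_mul, norm_mul, norm_pow, Real.norm_natCast, Real.norm_eq_abs]
    have hy' : ‖y‖ ≤ ρ := (mem_ball_zero_iff.1 hy).le
    gcongr
    exact ha n
  have hzmem : z ∈ ball (0 : ℝ) ρ := by simpa using hzρ
  have hderiv := hasDerivAt_tsum_of_isPreconnected hsum isOpen_ball
    (convex_ball (0 : ℝ) ρ).isPreconnected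
    (fun n y _ => (hasDerivAt_pow n y).const_mul (a n)) hbound (mem_ball_self hρ0)
    (summable_mul_pow_of_linear_bound ha (by simp)) hzmem
  refine hderiv.congr_deriv ?_
  rw [(Summable.of_norm_bounded hsum fun n => hbound n z hzmem).tsum_eq_zero_add]
  simp only [CharP.cast_eq_zero, zero_mul, mul_zero, zero_add, Nat.add_sub_cancel, Nat.cast_add,
    Nat.cast_one]
  exact tsum_congr fun n => by ring

theorem contDiffOn_tsum_mul_pow (ha : ∀ n, |a n| ≤ n + 1) :
    ContDiffOn ℝ 2 (fun z => ∑' n, a n * z ^ n) (Ioo (-1) 1) := by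
  have hradius : 1 ≤ (FormalMultilinearSeries.ofScalars ℝ a).radius := by
    refine ENNReal.le_of_forall_nnreal_lt fun r hr => ?_
    refine FormalMultilinearSeries.le_radius_of_summable _ ?_
    have hr1 : (r : ℝ) < 1 := by exact_mod_cast hr
    simp only [FormalMultilinearSeries.ofScalars_norm]
    have := summable_mul_pow_of_linear_bound (a := fun n => |a n|) (by simpa using ha)
      (z := r) (by simpa using hr1)
    simpa using this
  have hball := ((FormalMultilinearSeries.ofScalars ℝ a).hasFPowerSeriesOnBall
    (one_pos.trans_le hradius)).mono one_pos hradius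
  have hsum : (FormalMultilinearSeries.ofScalars ℝ a).sum = fun z => ∑' n, a n * z ^ n :=
    FormalMultilinearSeries.ofScalarsSum_eq_tsum a
  have han := hball.analyticOnNhd
  rw [hsum] at han
  refine han.contDiffOn isOpen_eball.uniqueDiffOn |>.mono ?_ |>.of_le le_top
  intro z hz
  simpa [abs_lt, edist_dist] using hz

/-- Multiplication by `1 - z` turns the series of partial sums into the original series. -/
theorem one_sub_mul_tsum_partial_sums {A : ℕ → ℝ} (hA : ∀ n, |A n| ≤ n + 1) (h0 : A 0 = a 0)
    (hsucc : ∀ n, A (n + 1) = A n + a (n + 1)) {z : ℝ} (hz : |z| < 1) :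
    (1 - z) * ∑' n, A n * z ^ n = ∑' n, a n * z ^ n := by
  have hsA := summable_mul_pow_of_linear_bound hA hz
  have hsA' := (summable_nat_add_iff 1).2 hsA
  have hzA := hsA.mul_left z
  have hsa' : Summable fun n => a (n + 1) * z ^ (n + 1) :=
    (hsA'.sub hzA).congr fun n => by rw [hsucc]; ring
  have hsa : Summable fun n => a n * z ^ n := (summable_nat_add_iff 1).1 hsa'
  have hsplit : ∑' n, A (n + 1) * z ^ (n + 1) =
      z * ∑' n, A n * z ^ n + ∑' n, a (n + 1) * z ^ (n + 1) := by
    rw [← tsum_mul_left, ← hzA.tsum_add hsa']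
    exact tsum_congr fun n => by rw [hsucc]; ring
  rw [hsa.tsum_eq_zero_add]
  have := hsA.tsum_eq_zero_add
  rw [hsplit, h0] at this
  linear_combination this

end PowerSeries

section RadialProfile

open Filter Topology

variable {𝕜 : Type*} [RCLike 𝕜]

/-- Partial sums of the coefficients of the radial profile and of its flux. -/
noncomputable def radialPartialSums (lam : 𝕜) : ℕ → 𝕜 × 𝕜
  | 0 => (1, 1)
  | n + 1 =>
    ((radialPartialSums lam n).1 - lam * (radialPartialSums lam n).2 / (n + 1),
      (radialPartialSums lam n).2 +
        ((radialPartialSums lam n).1 - lam * (radialPartialSums lam n).2 / (n + 1)) / (n + 2))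

/-- Taylor coefficients of the radial profile in the variable `r ^ 2 / (r ^ 2 + δ)`. -/
noncomputable def radialCoeff (lam : 𝕜) : ℕ → 𝕜
  | 0 => 1
  | n + 1 => -(lam * (radialPartialSums lam n).2 / (n + 1))

/-- Taylor coefficients of the flux of the radial profile. -/
noncomputable def fluxCoeff (lam : 𝕜) (n : ℕ) : 𝕜 := (radialPartialSums lam n).1 / (n + 1)

/-- The radial solution, normalised to be `1` at the centre, in the variable
`r ^ 2 / (r ^ 2 + δ)`. -/
noncomputable def radialProfile (lam z : 𝕜) : 𝕜 := ∑' n, radialCoeff lam n * z ^ n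

/-- The flux of the radial solution. -/
noncomputable def radialFlux (lam z : 𝕜) : 𝕜 := ∑' n, fluxCoeff lam n * z ^ n

theorem norm_radialPartialSums_le {lam : 𝕜} (hlam : ‖lam‖ ≤ 1) (n : ℕ) :
    ‖(radialPartialSums lam n).1‖ ≤ n + 1 ∧ ‖(radialPartialSums lam n).2‖ ≤ n + 1 := by
  have hcast (k : ℕ) (n : ℕ) : ‖((n : 𝕜) + (k : 𝕜))‖ = n + k := by
    rw [← Nat.cast_add, RCLike.norm_natCast]
    push_cast
    rfl
  induction n with
  | zero => simp [radialPartialSums]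
  | succ n ih =>
    obtain ⟨ih1, ih2⟩ := ih
    have hn : (0 : ℝ) < n + 1 := by positivity
    have hfirst : ‖(radialPartialSums lam (n + 1)).1‖ ≤ n + 2 := by
      have hquot : ‖lam * (radialPartialSums lam n).2 / (n + 1)‖ ≤ 1 := by
        have := hcast 1 n
        push_cast at this
        rw [norm_div, norm_mul, this, div_le_one hn]
        exact (mul_le_of_le_one_left (norm_nonneg _) hlam).trans ih2
      refine (norm_sub_le _ _).trans ?_
      linarith
    refine ⟨by push_cast; linarith, ?_⟩
    have hquot : ‖(radialPartialSums lam (n + 1)).1 / (n + 2)‖ ≤ 1 := by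
      have := hcast 2 n
      push_cast at this
      rw [norm_div, this, div_le_one (by positivity)]
      exact hfirst
    refine (norm_add_le _ _).trans ?_
    push_cast
    exact add_le_add ih2 hquot

theorem norm_radialCoeff_le_one {lam : 𝕜} (hlam : ‖lam‖ ≤ 1) (n : ℕ) :
    ‖radialCoeff lam n‖ ≤ 1 := by
  cases n with
  | zero => simp [radialCoeff]
  | succ n =>
    have hcast : ‖((n : 𝕜) + 1)‖ = n + 1 := by
      rw [← Nat.cast_succ, RCLike.norm_natCast]
      push_cast
      rfl
    rw [radialCoeff, norm_neg, norm_div, norm_mul, hcast, div_le_one (by positivity)]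
    exact (mul_le_of_le_one_left (norm_nonneg _) hlam).trans (norm_radialPartialSums_le hlam n).2

theorem norm_fluxCoeff_le_one {lam : 𝕜} (hlam : ‖lam‖ ≤ 1) (n : ℕ) : ‖fluxCoeff lam n‖ ≤ 1 := by
  have hcast : ‖((n : 𝕜) + 1)‖ = n + 1 := by
    rw [← Nat.cast_succ, RCLike.norm_natCast]
    push_cast
    rfl
  rw [fluxCoeff, norm_div, hcast, div_le_one (by positivity)]
  exact (norm_radialPartialSums_le hlam n).1

theorem radialProfile_zero_right (lam : 𝕜) : radialProfile lam 0 = 1 := by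
  rw [radialProfile, tsum_eq_single 0 fun n hn => by simp [hn]]
  simp [radialCoeff]

theorem radialProfile_zero_left (z : 𝕜) : radialProfile 0 z = 1 := by
  rw [radialProfile, tsum_eq_single 0]
  · simp [radialCoeff]
  · intro n hn
    obtain ⟨k, rfl⟩ := Nat.exists_eq_succ_of_ne_zero hn
    simp [radialCoeff]

theorem contDiff_radialPartialSums (n : ℕ) :
    ContDiff 𝕜 1 fun lam : 𝕜 => radialPartialSums lam n := by
  induction n with
  | zero => exact contDiff_const
  | succ n ih =>
    have hfirst : ContDiff 𝕜 1 fun lam : 𝕜 =>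
        (radialPartialSums lam n).1 - lam * (radialPartialSums lam n).2 / (n + 1) :=
      ih.fst.sub ((contDiff_id.mul ih.snd).div_const _)
    exact hfirst.prodMk (ih.snd.add (hfirst.div_const _))

theorem contDiff_radialCoeff (n : ℕ) : ContDiff 𝕜 1 fun lam : 𝕜 => radialCoeff lam n := by
  cases n with
  | zero => exact contDiff_const
  | succ n => exact ((contDiff_id.mul (contDiff_radialPartialSums n).snd).div_const _).neg

theorem contDiff_fluxCoeff (n : ℕ) : ContDiff 𝕜 1 fun lam : 𝕜 => fluxCoeff lam n :=
  (contDiff_radialPartialSums n).fst.div_const _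

theorem ofReal_radialProfile (lam z : ℝ) :
    ((radialProfile lam z : ℝ) : ℂ) = radialProfile (lam : ℂ) (z : ℂ) := by
  have hsums (n : ℕ) : radialPartialSums (lam : ℂ) n =
      (((radialPartialSums lam n).1 : ℂ), ((radialPartialSums lam n).2 : ℂ)) := by
    induction n with
    | zero => simp [radialPartialSums]
    | succ n ih => simp [radialPartialSums, ih]
  rw [radialProfile, radialProfile, Complex.ofReal_tsum]
  refine tsum_congr fun n => ?_
  cases n <;> simp [radialCoeff, hsums]

section Real

variable {lam z : ℝ}

theorem hasDerivAt_radialProfile (hlam : |lam| ≤ 1) (hz : |z| < 1) :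
    HasDerivAt (radialProfile lam) (-lam * radialFlux lam z / (1 - z)) z := by
  have hz1 : 1 - z ≠ 0 := by linarith [lt_of_abs_lt hz]
  have hbound (n : ℕ) : |radialCoeff lam n| ≤ n + 1 :=
    (norm_radialCoeff_le_one (𝕜 := ℝ) hlam n).trans (by simp)
  have hpart := one_sub_mul_tsum_partial_sums (a := fluxCoeff lam)
    (A := fun n => (radialPartialSums lam n).2)
    (fun n => (norm_radialPartialSums_le (𝕜 := ℝ) hlam n).2)
    (by simp [fluxCoeff, radialPartialSums])
    (fun n => by simp only [fluxCoeff, radialPartialSums]; push_cast; ring) hz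
  refine (hasDerivAt_tsum_mul_pow hbound hz).congr_deriv ?_
  rw [eq_div_iff hz1, radialFlux, ← hpart, mul_comm (1 - z), ← mul_assoc, ← tsum_mul_left]
  congr 1
  refine tsum_congr fun n => ?_
  have : (n : ℝ) + 1 ≠ 0 := by positivity
  simp only [radialCoeff]
  field_simp

theorem hasDerivAt_mul_radialFlux (hlam : |lam| ≤ 1) (hz : |z| < 1) :
    HasDerivAt (fun z => z * radialFlux lam z) (radialProfile lam z / (1 - z)) z := by
  have hz1 : 1 - z ≠ 0 := by linarith [lt_of_abs_lt hz]
  set q : ℕ → ℝ := fun n => Nat.casesOn n 0 (fluxCoeff lam) with hq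
  have hbound (n : ℕ) : |q n| ≤ n + 1 := by
    cases n with
    | zero => simp [hq]
    | succ n => exact (norm_fluxCoeff_le_one (𝕜 := ℝ) hlam n).trans (by push_cast; linarith)
  have hpart := one_sub_mul_tsum_partial_sums (a := radialCoeff lam)
    (A := fun n => (radialPartialSums lam n).1)
    (fun n => (norm_radialPartialSums_le (𝕜 := ℝ) hlam n).1)
    (by simp [radialCoeff, radialPartialSums])
    (fun n => by simp only [radialCoeff, radialPartialSums]; ring) hz
  have heq : (fun z => z * radialFlux lam z) =ᶠ[𝓝 z] fun z => ∑' n, q n * z ^ n := by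
    filter_upwards [(continuous_abs.isOpen_preimage _ isOpen_Iio).mem_nhds
      (show z ∈ abs ⁻¹' Iio 1 from hz)] with y hy
    rw [(summable_mul_pow_of_linear_bound hbound hy).tsum_eq_zero_add, radialFlux,
      ← tsum_mul_left]
    have hq0 : q 0 = 0 := rfl
    have hqs (n : ℕ) : q (n + 1) = fluxCoeff lam n := rfl
    rw [hq0, zero_mul, zero_add]
    exact tsum_congr fun n => by rw [hqs]; ring
  refine HasDerivAt.congr_of_eventuallyEq ?_ heq
  refine (hasDerivAt_tsum_mul_pow hbound hz).congr_deriv ?_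
  rw [eq_div_iff hz1, radialProfile, ← hpart, mul_comm (1 - z)]
  congr 1
  refine tsum_congr fun n => ?_
  have : (n : ℝ) + 1 ≠ 0 := by positivity
  simp only [hq, fluxCoeff]
  field_simp

theorem contDiffOn_radialProfile (hlam : |lam| ≤ 1) :
    ContDiffOn ℝ 2 (radialProfile lam) (Ioo (-1) 1) :=
  contDiffOn_tsum_mul_pow fun n => (norm_radialCoeff_le_one (𝕜 := ℝ) hlam n).trans (by simp)

theorem differentiableAt_radialFlux (hlam : |lam| ≤ 1) (hz : |z| < 1) :
    DifferentiableAt ℝ (radialFlux lam) z :=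
  (hasDerivAt_tsum_mul_pow (fun n => (norm_fluxCoeff_le_one (𝕜 := ℝ) hlam n).trans (by simp))
    hz).differentiableAt

theorem continuousOn_tsum_param {a : ℝ → ℕ → ℝ} (hcont : ∀ n, Continuous fun lam => a lam n)
    (hbound : ∀ lam, |lam| ≤ 1 → ∀ n, |a lam n| ≤ 1) {ρ : ℝ} (hρ0 : 0 ≤ ρ) (hρ : ρ < 1) :
    ContinuousOn (fun p : ℝ × ℝ => ∑' n, a p.1 n * p.2 ^ n) {p | |p.1| ≤ 1 ∧ |p.2| ≤ ρ} := by
  refine continuousOn_tsum (u := fun n => ρ ^ n) ?_ (summable_geometric_of_lt_one hρ0 hρ) ?_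
  · intro n
    exact (((hcont n).comp continuous_fst).mul (continuous_snd.pow n)).continuousOn
  · rintro n p ⟨h1, h2⟩
    rw [norm_mul, norm_pow, Real.norm_eq_abs, Real.norm_eq_abs]
    calc |a p.1 n| * |p.2| ^ n ≤ 1 * ρ ^ n := by
          gcongr
          exact hbound _ h1 n
      _ = ρ ^ n := one_mul _

end Real

/-- The boundary value of the radial profile has only finitely many zeros. -/
theorem finite_radialProfile_zeros {z b : ℝ} (hz : |z| < 1) (hb : b < 1) :
    {lam ∈ Icc 0 b | radialProfile lam z = 0}.Finite := by
  set F : ℂ → ℂ := fun lam => radialProfile lam (z : ℂ) with hF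
  have hdiff : DifferentiableOn ℂ F (ball 0 1) := by
    refine Complex.differentiableOn_tsum_of_summable_norm
      (summable_geometric_of_lt_one (abs_nonneg z) hz) (fun n => ?_) isOpen_ball fun n w hw => ?_
    · exact (((contDiff_radialCoeff n).differentiable (by simp)).mul_const _).differentiableOn
    · rw [norm_mul, norm_pow, Complex.norm_real, Real.norm_eq_abs]
      exact mul_le_of_le_one_left (by positivity)
        (norm_radialCoeff_le_one (mem_ball_zero_iff.1 hw).le n)
  have han := hdiff.analyticOnNhd isOpen_ball
  by_contra hinf
  obtain ⟨x, hx, hacc⟩ := Set.Infinite.exists_accPt_of_subset_isCompact hinf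
    (isCompact_Icc (a := (0 : ℝ)) (b := b)) fun y hy => hy.1
  have hxmem : (x : ℂ) ∈ ball (0 : ℂ) 1 := by
    rw [mem_ball_zero_iff, Complex.norm_real, Real.norm_eq_abs, abs_of_nonneg hx.1]
    exact hx.2.trans_lt hb
  have hfreq : ∃ᶠ w in 𝓝[≠] (x : ℂ), F w = 0 := by
    have htend : Tendsto (fun t : ℝ => (t : ℂ)) (𝓝[≠] x) (𝓝[≠] (x : ℂ)) := by
      refine tendsto_nhdsWithin_of_tendsto_nhds_of_eventually_within _
        (Complex.continuous_ofReal.continuousAt.tendsto.mono_left nhdsWithin_le_nhds) ?_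
      filter_upwards [self_mem_nhdsWithin] with t ht
      simpa using ht
    refine htend.frequently ?_
    refine (accPt_iff_frequently_nhdsNE.1 hacc).mono fun t ht => ?_
    rw [hF]
    simp only
    rw [← ofReal_radialProfile, ht.2, Complex.ofReal_zero]
  have hzero := han.eqOn_zero_of_preconnected_of_frequently_eq_zero
    (convex_ball (0 : ℂ) 1).isPreconnected hxmem hfreq (mem_ball_self one_pos)
  simp [hF, radialProfile_zero_left] at hzero

end RadialProfile

section Prufer

open Filter Topology

/-- Squared Prüfer radius of the radial profile with eigenvalue parameter `ν ^ 2`. -/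
noncomputable def pruferRadiusSq (ν z : ℝ) : ℝ :=
  radialProfile (ν ^ 2) z ^ 2 + ν ^ 2 * (z * radialFlux (ν ^ 2) z) ^ 2

/-- Angular velocity of the Prüfer angle of the radial profile. -/
noncomputable def pruferSpeed (ν z : ℝ) : ℝ :=
  (ν * radialProfile (ν ^ 2) z ^ 2 + ν ^ 3 * z * radialFlux (ν ^ 2) z ^ 2) /
    (pruferRadiusSq ν z * (1 - z))

theorem abs_sq_le_one_of_abs_le_one {ν : ℝ} (hν : |ν| ≤ 1) : |ν ^ 2| ≤ 1 := by
  rw [abs_pow]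
  exact pow_le_one₀ (abs_nonneg ν) hν

theorem pruferRadiusSq_pos {ν z : ℝ} (hν : |ν| ≤ 1) (hz0 : 0 ≤ z) (hz1 : z < 1) :
    0 < pruferRadiusSq ν z := by
  have hlam := abs_sq_le_one_of_abs_le_one hν
  have habs {s : ℝ} (hs : s ∈ Icc 0 z) : |s| < 1 := by
    rw [abs_of_nonneg hs.1]
    exact hs.2.trans_lt hz1
  set W : ℝ → ℝ := fun s =>
    s * radialProfile (ν ^ 2) s ^ 2 + ν ^ 2 * (s * radialFlux (ν ^ 2) s) ^ 2 with hW
  have hderiv {s : ℝ} (hs : s ∈ Icc 0 z) : HasDerivAt W (radialProfile (ν ^ 2) s ^ 2) s := by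
    have h1 := hasDerivAt_radialProfile hlam (habs hs)
    have h2 := hasDerivAt_mul_radialFlux hlam (habs hs)
    have hs1 : 1 - s ≠ 0 := by linarith [hs.2]
    refine (((hasDerivAt_id s).mul (h1.pow 2)).add ((h2.pow 2).const_mul (ν ^ 2))).congr_deriv ?_
    simp only [id, Pi.pow_apply]
    push_cast
    field_simp
    ring
  have hmono : MonotoneOn W (Icc 0 z) := by
    refine monotoneOn_of_deriv_nonneg (convex_Icc 0 z)
      (fun s hs => (hderiv hs).continuousAt.continuousWithinAt)
      (fun s hs => (hderiv (interior_subset hs)).differentiableAt.differentiableWithinAt)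
      fun s hs => ?_
    rw [(hderiv (interior_subset hs)).deriv]
    positivity
  have hnonneg : 0 ≤ pruferRadiusSq ν z := by
    unfold pruferRadiusSq
    positivity
  refine hnonneg.lt_of_ne' fun hzero => ?_
  have hf : radialProfile (ν ^ 2) z ^ 2 = 0 := by
    have h1 := sq_nonneg (radialProfile (ν ^ 2) z)
    have h2 : 0 ≤ ν ^ 2 * (z * radialFlux (ν ^ 2) z) ^ 2 := by positivity
    unfold pruferRadiusSq at hzero
    linarith
  have hWz : W z = 0 := by
    simp only [hW]
    unfold pruferRadiusSq at hzero
    rw [hf] at hzero ⊢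
    linarith
  have hprofile {s : ℝ} (hs : s ∈ Ioc 0 z) : radialProfile (ν ^ 2) s = 0 := by
    have hle := hmono ⟨hs.1.le, hs.2⟩ (right_mem_Icc.2 hz0) hs.2
    rw [hWz] at hle
    have h2 : 0 ≤ ν ^ 2 * (s * radialFlux (ν ^ 2) s) ^ 2 := by positivity
    have hle' : s * radialProfile (ν ^ 2) s ^ 2 ≤ 0 := by
      simp only [hW] at hle
      linarith
    have := nonpos_of_mul_nonpos_right hle' hs.1
    exact pow_eq_zero_iff two_ne_zero |>.1 (le_antisymm this (sq_nonneg _))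
  have hzpos : 0 < z := hz0.lt_of_ne fun h => by
    rw [← h, radialProfile_zero_right] at hf
    norm_num at hf
  have hcont : Tendsto (radialProfile (ν ^ 2)) (𝓝[>] (0 : ℝ)) (𝓝 1) := by
    have := (hasDerivAt_radialProfile hlam (z := 0) (by simp)).continuousAt.tendsto
    rw [radialProfile_zero_right] at this
    exact this.mono_left nhdsWithin_le_nhds
  have hlim : Tendsto (radialProfile (ν ^ 2)) (𝓝[>] (0 : ℝ)) (𝓝 0) := by
    refine tendsto_const_nhds.congr' ?_
    filter_upwards [Ioc_mem_nhdsGT hzpos] with s hs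
    exact (hprofile hs).symm
  exact one_ne_zero (tendsto_nhds_unique hcont hlim)

theorem le_pruferSpeed {ν z : ℝ} (hν0 : 0 ≤ ν) (hν : ν ≤ 1) (hz0 : 0 ≤ z) (hz1 : z < 1) :
    ν / (1 - z) ≤ pruferSpeed ν z := by
  have hD := pruferRadiusSq_pos (abs_le.2 ⟨by linarith, hν⟩) hz0 hz1
  have h1 : 0 < 1 - z := by linarith
  rw [pruferSpeed, div_le_div_iff₀ h1 (by positivity)]
  have : 0 ≤ ν ^ 3 * z * radialFlux (ν ^ 2) z ^ 2 * (1 - z) * (1 - z) := by positivity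
  unfold pruferRadiusSq
  linarith

theorem continuousOn_pruferSpeed {ρ : ℝ} (hρ0 : 0 ≤ ρ) (hρ : ρ < 1) :
    ContinuousOn (Function.uncurry pruferSpeed) (Icc 0 1 ×ˢ Icc 0 ρ) := by
  have hmaps : MapsTo (fun p : ℝ × ℝ => (p.1 ^ 2, p.2)) (Icc 0 1 ×ˢ Icc 0 ρ)
      {p | |p.1| ≤ 1 ∧ |p.2| ≤ ρ} := by
    rintro p ⟨h1, h2⟩
    refine ⟨abs_sq_le_one_of_abs_le_one ?_, ?_⟩
    · rw [abs_of_nonneg h1.1]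
      exact h1.2
    · simp only
      rw [abs_of_nonneg h2.1]
      exact h2.2
  have hsq : ContinuousOn (fun p : ℝ × ℝ => (p.1 ^ 2, p.2)) (Icc 0 1 ×ˢ Icc 0 ρ) := by fun_prop
  have hf : ContinuousOn (fun p : ℝ × ℝ => radialProfile (p.1 ^ 2) p.2) (Icc 0 1 ×ˢ Icc 0 ρ) :=
    (continuousOn_tsum_param (fun n => (contDiff_radialCoeff (𝕜 := ℝ) n).continuous)
      (fun _ h n => norm_radialCoeff_le_one (𝕜 := ℝ) h n) hρ0 hρ).comp hsq hmaps
  have hp : ContinuousOn (fun p : ℝ × ℝ => radialFlux (p.1 ^ 2) p.2) (Icc 0 1 ×ˢ Icc 0 ρ) :=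
    (continuousOn_tsum_param (fun n => (contDiff_fluxCoeff (𝕜 := ℝ) n).continuous)
      (fun _ h n => norm_fluxCoeff_le_one (𝕜 := ℝ) h n) hρ0 hρ).comp hsq hmaps
  unfold pruferSpeed pruferRadiusSq
  refine ContinuousOn.div (by fun_prop) (by fun_prop) ?_
  rintro p ⟨h1, h2⟩
  have hz1 : p.2 < 1 := h2.2.trans_lt hρ
  have hD := pruferRadiusSq_pos (abs_le.2 ⟨by linarith [h1.1], h1.2⟩) h2.1 hz1
  exact mul_ne_zero hD.ne' (by linarith)

/-- If the primitive of the Prüfer speed is an odd multiple of `π / 2`, the profile vanishes. -/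
theorem radialProfile_eq_zero_of_cos_eq_zero {ν ρ : ℝ} {θ : ℝ → ℝ} (hν : |ν| ≤ 1) (hρ0 : 0 ≤ ρ)
    (hρ : ρ < 1) (hθ0 : θ 0 = 0) (hθ : ∀ z ∈ Icc 0 ρ, HasDerivAt θ (pruferSpeed ν z) z)
    (hcos : Real.cos (θ ρ) = 0) : radialProfile (ν ^ 2) ρ = 0 := by
  have hlam := abs_sq_le_one_of_abs_le_one hν
  set y : ℝ → ℝ := fun z => radialProfile (ν ^ 2) z * Real.sin (θ z) -
    ν * (z * radialFlux (ν ^ 2) z) * Real.cos (θ z) with hy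
  have hderiv {z : ℝ} (hz : z ∈ Icc 0 ρ) :
      HasDerivAt (fun z => y z ^ 2 / pruferRadiusSq ν z) 0 z := by
    have hz1 : z < 1 := hz.2.trans_lt hρ
    have habs : |z| < 1 := by rwa [abs_of_nonneg hz.1]
    have hf := hasDerivAt_radialProfile hlam habs
    have hp := hasDerivAt_mul_radialFlux hlam habs
    have hD := pruferRadiusSq_pos hν hz.1 hz1
    have h1 : 1 - z ≠ 0 := by linarith
    have hyd := (hf.mul (hθ z hz).sin).sub ((hp.const_mul ν).mul (hθ z hz).cos)
    have hDd := (hf.pow 2).add ((hp.pow 2).const_mul (ν ^ 2))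
    have hquot := (hyd.pow 2).div hDd hD.ne'
    refine hquot.congr_deriv ?_
    rw [div_eq_zero_iff]
    left
    have hspeed : pruferSpeed ν z * pruferRadiusSq ν z =
        (ν * radialProfile (ν ^ 2) z ^ 2 + ν ^ 3 * z * radialFlux (ν ^ 2) z ^ 2) / (1 - z) := by
      unfold pruferSpeed
      field_simp
    unfold pruferRadiusSq at hspeed
    simp only [Pi.sub_apply, Pi.mul_apply, Pi.add_apply, Pi.pow_apply]
    generalize pruferSpeed ν z = w at *
    generalize radialProfile (ν ^ 2) z = f at *
    generalize radialFlux (ν ^ 2) z = p at *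
    generalize Real.sin (θ z) = s at *
    generalize Real.cos (θ z) = c at *
    push_cast
    linear_combination 2 * (f * s - ν * (z * p) * c) * (f * c + ν * (z * p) * s) * hspeed
  have hconst := constant_of_has_deriv_right_zero (a := 0) (b := ρ)
    (fun z hz => (hderiv hz).continuousAt.continuousWithinAt)
    (fun z hz => (hderiv ⟨hz.1, hz.2.le⟩).hasDerivWithinAt) ρ (right_mem_Icc.2 hρ0)
  have hy0 : y 0 = 0 := by simp [hy, hθ0]
  simp only [hy0] at hconst
  have hD := pruferRadiusSq_pos hν hρ0 hρ
  have hyρ : y ρ = 0 := by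
    rw [zero_pow two_ne_zero, zero_div, div_eq_zero_iff] at hconst
    exact pow_eq_zero_iff two_ne_zero |>.1 (hconst.resolve_right hD.ne')
  simp only [hy, hcos, mul_zero, sub_zero] at hyρ
  refine (mul_eq_zero.1 hyρ).resolve_right fun hsin => ?_
  have := Real.sin_sq_add_cos_sq (θ ρ)
  rw [hsin, hcos] at this
  norm_num at this

theorem exists_radialProfile_eq_zero_of_cos_eq_zero {ρ : ℝ} (hρ0 : 0 ≤ ρ) (hρ : ρ < 1) :
    ∃ Θ : ℝ → ℝ, ContinuousOn Θ (Icc 0 1) ∧ Θ 0 = 0 ∧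
      (∀ ν ∈ Icc (0 : ℝ) 1, ν * -Real.log (1 - ρ) ≤ Θ ν) ∧
      ∀ ν ∈ Icc (0 : ℝ) 1, Real.cos (Θ ν) = 0 → radialProfile (ν ^ 2) ρ = 0 := by
  set H : ℝ → ℝ → ℝ := fun ν s =>
    pruferSpeed (projIcc 0 1 zero_le_one ν) (projIcc 0 ρ hρ0 s) with hH
  have hHcont : Continuous (Function.uncurry H) := by
    refine (continuousOn_pruferSpeed hρ0 hρ).comp_continuous
      (f := fun p : ℝ × ℝ => ((projIcc 0 1 zero_le_one p.1 : ℝ), (projIcc 0 ρ hρ0 p.2 : ℝ)))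
      (by fun_prop) fun p => ⟨Subtype.coe_prop _, Subtype.coe_prop _⟩
  have hHeq {ν z : ℝ} (hν : ν ∈ Icc (0 : ℝ) 1) (hz : z ∈ Icc 0 ρ) : H ν z = pruferSpeed ν z := by
    simp only [hH]
    rw [projIcc_of_mem _ hν, projIcc_of_mem _ hz]
  have hderiv {ν z : ℝ} (hν : ν ∈ Icc (0 : ℝ) 1) (hz : z ∈ Icc 0 ρ) :
      HasDerivAt (fun z => ∫ s in (0 : ℝ)..z, H ν s) (pruferSpeed ν z) z := by
    rw [← hHeq hν hz]
    have hc : Continuous (H ν) := hHcont.uncurry_left ν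
    exact intervalIntegral.integral_hasDerivAt_right (hc.intervalIntegrable _ _)
      (hc.stronglyMeasurableAtFilter _ _) hc.continuousAt
  refine ⟨fun ν => ∫ s in (0 : ℝ)..ρ, H ν s, ?_, ?_, fun ν hν => ?_, fun ν hν hcos => ?_⟩
  · exact (intervalIntegral.continuous_parametric_intervalIntegral_of_continuous'
      hHcont 0 ρ).continuousOn
  · simp [hH, pruferSpeed]
  · have hmono : MonotoneOn (fun z => (∫ s in (0 : ℝ)..z, H ν s) + ν * Real.log (1 - z))
        (Icc 0 ρ) := by
      have hd {z : ℝ} (hz : z ∈ Icc 0 ρ) :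
          HasDerivAt (fun z => (∫ s in (0 : ℝ)..z, H ν s) + ν * Real.log (1 - z))
            (pruferSpeed ν z - ν / (1 - z)) z := by
        have h1 : 1 - z ≠ 0 := by linarith [hz.2]
        refine ((hderiv hν hz).add
          ((((hasDerivAt_id z).const_sub 1).log h1).const_mul ν)).congr_deriv ?_
        simp only [id]
        ring
      refine monotoneOn_of_deriv_nonneg (convex_Icc 0 ρ)
        (fun z hz => (hd hz).continuousAt.continuousWithinAt)
        (fun z hz => (hd (interior_subset hz)).differentiableAt.differentiableWithinAt)
        fun z hz => ?_
      have hz' := interior_subset hz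
      rw [(hd hz').deriv, sub_nonneg]
      exact le_pruferSpeed hν.1 hν.2 hz'.1 (hz'.2.trans_lt hρ)
    have := hmono (left_mem_Icc.2 hρ0) (right_mem_Icc.2 hρ0) hρ0
    simp only [intervalIntegral.integral_same, sub_zero, Real.log_one, mul_zero, add_zero] at this
    linarith
  · exact radialProfile_eq_zero_of_cos_eq_zero (abs_le.2 ⟨by linarith [hν.1], hν.2⟩) hρ0 hρ
      intervalIntegral.integral_same (fun z hz => hderiv hν hz) hcos

/-- The profile has at least `m` zeros in the spectral parameter as soon as the Prüfer angle
reaches `(2 m - 1) π / 2`. -/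
theorem le_card_radialProfile_zeros {ρ b : ℝ} (hρ0 : 0 ≤ ρ) (hρ : ρ < 1) (hb0 : 0 ≤ b)
    (hb1 : b < 1) {m : ℕ} (hm : (2 * (m : ℝ) - 1) * π / 2 ≤ b * -Real.log (1 - ρ))
    (hfin : {lam ∈ Icc 0 (b ^ 2) | radialProfile lam ρ = 0}.Finite) :
    m ≤ hfin.toFinset.card := by
  obtain ⟨Θ, hcont, hΘ0, hlow, hzero⟩ := exists_radialProfile_eq_zero_of_cos_eq_zero hρ0 hρ
  have hex (k : ℕ) (hk : k < m) : ∃ ν ∈ Icc 0 b, Θ ν = (2 * (k : ℝ) + 1) * π / 2 := by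
    have hsub : Icc 0 b ⊆ Icc (0 : ℝ) 1 := Icc_subset_Icc_right hb1.le
    have himage := intermediate_value_Icc hb0 (hcont.mono hsub)
    refine himage ⟨?_, le_trans ?_ (hm.trans (hlow b ⟨hb0, hb1.le⟩))⟩
    · rw [hΘ0]
      positivity
    · have hk' : (k : ℝ) + 1 ≤ m := by exact_mod_cast hk
      have := Real.pi_pos
      gcongr
      linarith
  choose! ν hν hΘν using hex
  have hcard : (Finset.range m).card ≤ hfin.toFinset.card := by
    refine Finset.card_le_card_of_injOn (fun k => ν k ^ 2) (fun k hk => ?_) fun k hk l hl hkl => ?_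
    · have hk' := Finset.mem_range.1 hk
      have hmem := hν k hk'
      rw [Finset.mem_coe, Set.Finite.mem_toFinset]
      refine ⟨⟨by positivity, pow_le_pow_left₀ hmem.1 hmem.2 2⟩, ?_⟩
      refine hzero _ ⟨hmem.1, hmem.2.trans hb1.le⟩ ?_
      rw [hΘν k hk', Real.cos_eq_zero_iff]
      exact ⟨k, by push_cast; rfl⟩
    · have hk' := Finset.mem_range.1 hk
      have hl' := Finset.mem_range.1 hl
      have hkl' : ν k = ν l := (sq_eq_sq₀ (hν k hk').1 (hν l hl').1).1 hkl
      have := hΘν k hk'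
      rw [hkl', hΘν l hl'] at this
      have hpi := Real.pi_pos.ne'
      field_simp at this
      have : (l : ℝ) = k := by linarith
      exact_mod_cast this.symm
  simpa using hcard

end Prufer

section RadialEigenfunction

open Filter Topology InnerProductSpace Laplacian

variable {δ lam : ℝ}

/-- The radial solution on the disc, normalised to be `1` at the centre. -/
noncomputable def radialEigenfunction (δ lam : ℝ) (x : EuclideanSpace ℝ (Fin 2)) : ℝ :=
  radialProfile lam (‖x‖ ^ 2 / (‖x‖ ^ 2 + δ))

theorem hasDerivAt_self_div_self_add {s : ℝ} (hs : s + δ ≠ 0) :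
    HasDerivAt (fun s => s / (s + δ)) (δ / (s + δ) ^ 2) s := by
  refine ((hasDerivAt_id s).div ((hasDerivAt_id s).add_const δ) hs).congr_deriv ?_
  simp only [id]
  ring

theorem abs_self_div_self_add_lt_one {s : ℝ} (hδ : 0 < δ) (hs : -(δ / 2) < s) :
    |s / (s + δ)| < 1 := by
  have hpos : 0 < s + δ := by linarith
  rw [abs_div, abs_of_pos hpos, div_lt_one hpos, abs_lt]
  constructor <;> linarith

theorem hasDerivAt_radialProfile_div {s : ℝ} (hδ : 0 < δ) (hlam : |lam| ≤ 1) (hs : -(δ / 2) < s) :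
    HasDerivAt (fun s => radialProfile lam (s / (s + δ)))
      (-lam * radialFlux lam (s / (s + δ)) / (s + δ)) s := by
  have hpos : s + δ ≠ 0 := by linarith
  refine ((hasDerivAt_radialProfile hlam (abs_self_div_self_add_lt_one hδ hs)).comp s
    (hasDerivAt_self_div_self_add hpos)).congr_deriv ?_
  have h1 : 1 - s / (s + δ) = δ / (s + δ) := by
    field_simp
    ring
  rw [h1]
  field_simp

theorem exists_hasDerivAt_radialFlux_div {s : ℝ} (hδ : 0 < δ) (hlam : |lam| ≤ 1)
    (hs : -(δ / 2) < s) :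
    ∃ c, HasDerivAt (fun s => -lam * radialFlux lam (s / (s + δ)) / (s + δ)) c s ∧
      s * c + -lam * radialFlux lam (s / (s + δ)) / (s + δ) =
        -lam * radialProfile lam (s / (s + δ)) / (s + δ) := by
  have hpos : s + δ ≠ 0 := by linarith
  have hz := abs_self_div_self_add_lt_one hδ hs
  have hdiv := hasDerivAt_self_div_self_add hpos
  have hflux := (((differentiableAt_radialFlux hlam hz).hasDerivAt.comp s hdiv).const_mul
    (-lam)).div ((hasDerivAt_id s).add_const δ) hpos
  refine ⟨_, hflux, ?_⟩
  have hprod := (hasDerivAt_id s).mul hflux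
  have hprod' := ((hasDerivAt_mul_radialFlux hlam hz).comp s hdiv).const_mul (-lam)
  have heq : (id * ((fun y => -lam * (radialFlux lam ∘ fun s => s / (s + δ)) y) /
      fun y => id y + δ)) =
      fun y => -lam * ((fun z => z * radialFlux lam z) ∘ fun s => s / (s + δ)) y := by
    funext y
    simp only [Pi.mul_apply, Pi.div_apply, Function.comp_apply, id]
    ring
  rw [heq] at hprod
  have := hprod.unique hprod'
  have h1 : 1 - s / (s + δ) = δ / (s + δ) := by
    field_simp
    ring
  rw [h1] at this
  simp only [id, Pi.div_apply, Function.comp_apply] at this ⊢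
  rw [add_comm, ← one_mul (-lam * radialFlux lam (s / (s + δ)) / (s + δ)), this]
  field_simp

theorem contDiff_radialEigenfunction (hδ : 0 < δ) (hlam : |lam| ≤ 1) :
    ContDiff ℝ 2 (radialEigenfunction δ lam) := by
  have hpos (x : EuclideanSpace ℝ (Fin 2)) : ‖x‖ ^ 2 + δ ≠ 0 := by positivity
  have hdiv : ContDiff ℝ 2 fun x : EuclideanSpace ℝ (Fin 2) => ‖x‖ ^ 2 / (‖x‖ ^ 2 + δ) :=
    (contDiff_norm_sq ℝ).div ((contDiff_norm_sq ℝ).add contDiff_const) hpos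
  refine contDiffOn_univ.1 ((contDiffOn_radialProfile hlam).comp hdiv.contDiffOn fun x _ => ?_)
  have := abs_self_div_self_add_lt_one hδ (s := ‖x‖ ^ 2) (by nlinarith [sq_nonneg ‖x‖])
  exact abs_lt.1 this

theorem isDiscSolution_radialEigenfunction (hδ : 0 < δ) (hlam : |lam| ≤ 1) :
    IsDiscSolution δ (4 * lam) (radialEigenfunction δ lam) := by
  have hcd := contDiff_radialEigenfunction hδ hlam
  refine ⟨hcd.contDiffOn, fun x _ => ?_⟩
  rw [laplacian_eq_sum_deriv_deriv hcd.contDiffAt]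
  have hx : -(δ / 2) < ‖x‖ ^ 2 := by nlinarith [sq_nonneg ‖x‖]
  obtain ⟨c, hc, hode⟩ := exists_hasDerivAt_radialFlux_div hδ hlam hx
  set g' : ℝ → ℝ := fun s => -lam * radialFlux lam (s / (s + δ)) / (s + δ) with hg'
  have hsecond (i : Fin 2) :
      deriv (deriv fun t : ℝ => radialEigenfunction δ lam (x + t • EuclideanSpace.single i 1)) 0 =
        4 * x i ^ 2 * c + 2 * g' (‖x‖ ^ 2) := by
    have hq (t : ℝ) : HasDerivAt (fun t => ‖x‖ ^ 2 + 2 * x i * t + t ^ 2) (2 * x i + 2 * t) t := by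
      refine ((((hasDerivAt_id t).const_mul (2 * x i)).const_add (‖x‖ ^ 2)).add
        (hasDerivAt_pow 2 t)).congr_deriv ?_
      push_cast
      ring
    have hfirst : deriv (fun t : ℝ =>
        radialEigenfunction δ lam (x + t • EuclideanSpace.single i 1)) =
        fun t => g' (‖x‖ ^ 2 + 2 * x i * t + t ^ 2) * (2 * x i + 2 * t) := by
      funext t
      have ht : -(δ / 2) < ‖x‖ ^ 2 + 2 * x i * t + t ^ 2 := by
        rw [← norm_add_smul_single_sq]
        nlinarith [sq_nonneg ‖x + t • EuclideanSpace.single i (1 : ℝ)‖]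
      have hfun : (fun t : ℝ => radialEigenfunction δ lam (x + t • EuclideanSpace.single i 1)) =
          (fun s => radialProfile lam (s / (s + δ))) ∘
            fun t => ‖x‖ ^ 2 + 2 * x i * t + t ^ 2 := by
        funext t
        rw [radialEigenfunction, norm_add_smul_single_sq]
        rfl
      rw [hfun]
      exact ((hasDerivAt_radialProfile_div hδ hlam ht).comp t (hq t)).deriv
    rw [hfirst]
    have hc' : HasDerivAt g' c (‖x‖ ^ 2 + 2 * x i * 0 + 0 ^ 2) := by simpa using hc
    have := (hc'.comp (0 : ℝ) (hq 0)).mul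
      (((hasDerivAt_id (0 : ℝ)).const_mul 2).const_add (2 * x i))
    refine this.deriv.trans ?_
    simp only [Function.comp_apply, id]
    ring_nf
  simp only [hsecond, Fin.sum_univ_two]
  have hsum := sum_sq_eq_norm_sq x
  rw [radialEigenfunction]
  have hrhs : 4 * lam / (‖x‖ ^ 2 + δ) * radialProfile lam (‖x‖ ^ 2 / (‖x‖ ^ 2 + δ)) =
      -4 * (-lam * radialProfile lam (‖x‖ ^ 2 / (‖x‖ ^ 2 + δ)) / (‖x‖ ^ 2 + δ)) := by ring
  rw [hrhs, ← hode]
  linear_combination 4 * c * hsum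

theorem radialEigenfunction_zero : radialEigenfunction δ lam 0 = 1 := by
  simp [radialEigenfunction, radialProfile_zero_right]

theorem radialEigenfunction_of_norm_eq_one {x : EuclideanSpace ℝ (Fin 2)} (hx : ‖x‖ = 1) :
    radialEigenfunction δ lam x = radialProfile lam (1 / (1 + δ)) := by
  rw [radialEigenfunction, hx, one_pow]

theorem isDirichletEigenfunction_radialEigenfunction (hδ : 0 < δ) (hlam : |lam| ≤ 1)
    (hzero : radialProfile lam (1 / (1 + δ)) = 0) {γ : ℝ}
    (hγ : γ / Real.log ((1 + δ) / δ) = 4 * lam) :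
    IsDirichletEigenfunction δ γ (radialEigenfunction δ lam) := by
  rw [isDirichletEigenfunction_iff, hγ]
  refine ⟨(contDiff_radialEigenfunction hδ hlam).continuous.continuousOn,
    isDiscSolution_radialEigenfunction hδ hlam,
    ⟨0, mem_ball_self one_pos, by simp [radialEigenfunction_zero]⟩, fun x hx => ?_⟩
  rw [radialEigenfunction_of_norm_eq_one (mem_sphere_zero_iff_norm.1 hx), hzero]

variable {γ : ℝ} {u : EuclideanSpace ℝ (Fin 2) → ℝ}

theorem IsDirichletEigenfunction.pos (hδ : 0 < δ) (hu : IsDirichletEigenfunction δ γ u) :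
    0 < γ / Real.log ((1 + δ) / δ) := by
  obtain ⟨hc, hsol, ⟨x, hx, hne⟩, hbdry⟩ := isDirichletEigenfunction_iff.1 hu
  by_contra! hμ
  have hle := hsol.nonpos_of_nonpos hδ hμ hc hbdry (ball_subset_closedBall hx)
  have hge := (hsol.const_smul (-1)).nonpos_of_nonpos hδ hμ (hc.const_smul (-1))
    (fun y hy => by simp [hbdry y hy]) (ball_subset_closedBall hx)
  simp only [Pi.smul_apply, smul_eq_mul] at hge
  exact hne (by linarith)

theorem IsDirichletEigenfunction.eq_of_norm_eq (hδ : 0 < δ) (hu : IsDirichletEigenfunction δ γ u)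
    (hμ : γ / Real.log ((1 + δ) / δ) < 1) {x y : EuclideanSpace ℝ (Fin 2)}
    (hx : x ∈ closedBall 0 1) (hxy : ‖x‖ = ‖y‖) : u x = u y := by
  obtain ⟨hc, hsol, -, hbdry⟩ := isDirichletEigenfunction_iff.1 hu
  have hy : y ∈ closedBall (0 : EuclideanSpace ℝ (Fin 2)) 1 := by
    rw [mem_closedBall_zero_iff] at hx ⊢
    rwa [← hxy]
  exact le_antisymm (hsol.le_of_norm_eq hδ (hu.pos hδ) hμ hc hbdry hx hxy)
    (hsol.le_of_norm_eq hδ (hu.pos hδ) hμ hc hbdry hy hxy.symm)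

theorem IsDirichletEigenfunction.eq_smul_radialEigenfunction (hδ : 0 < δ)
    (hu : IsDirichletEigenfunction δ γ u) (hμ : γ / Real.log ((1 + δ) / δ) < 1) :
    ∀ x ∈ closedBall 0 1,
      u x = u 0 * radialEigenfunction δ (γ / Real.log ((1 + δ) / δ) / 4) x := by
  obtain ⟨hc, hsol, -, -⟩ := isDirichletEigenfunction_iff.1 hu
  have hpos := hu.pos hδ
  set lam := γ / Real.log ((1 + δ) / δ) / 4 with hlam
  have hlam1 : |lam| ≤ 1 := by
    rw [abs_le]
    constructor <;> linarith
  have hU := isDiscSolution_radialEigenfunction hδ hlam1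
  rw [show 4 * lam = γ / Real.log ((1 + δ) / δ) by rw [hlam]; ring] at hU
  have hball := (hsol.sub (hU.const_smul (u 0))).eq_zero_of_radial hδ hpos
    (fun x hx y hxy => by
      simp only [Pi.sub_apply, Pi.smul_apply, radialEigenfunction, hxy,
        hu.eq_of_norm_eq hδ hμ (ball_subset_closedBall hx) hxy])
    (by simp [radialEigenfunction_zero])
  have heq : EqOn u (fun x => u 0 * radialEigenfunction δ lam x) (ball 0 1) := fun x hx => by
    simpa [sub_eq_zero] using hball x hx
  exact heq.of_subset_closure hc
    (continuous_const.mul (contDiff_radialEigenfunction hδ hlam1).continuous).continuousOn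
    ball_subset_closedBall (closure_ball _ one_ne_zero).ge

theorem IsDirichletEigenfunction.apply_zero_ne_zero (hδ : 0 < δ)
    (hu : IsDirichletEigenfunction δ γ u) (hμ : γ / Real.log ((1 + δ) / δ) < 1) : u 0 ≠ 0 := by
  obtain ⟨x, hx, hne⟩ := hu.2.2.1
  intro h0
  rw [hu.eq_smul_radialEigenfunction hδ hμ x (ball_subset_closedBall hx), h0, zero_mul] at hne
  exact hne rfl

theorem IsDirichletEigenfunction.radialProfile_eq_zero (hδ : 0 < δ)
    (hu : IsDirichletEigenfunction δ γ u) (hμ : γ / Real.log ((1 + δ) / δ) < 1) :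
    radialProfile (γ / Real.log ((1 + δ) / δ) / 4) (1 / (1 + δ)) = 0 := by
  have hnorm : ‖(EuclideanSpace.single 0 1 : EuclideanSpace ℝ (Fin 2))‖ = 1 := by simp
  have hmem := mem_sphere_zero_iff_norm.2 hnorm
  have h := hu.eq_smul_radialEigenfunction hδ hμ _ (sphere_subset_closedBall hmem)
  rw [hu.2.2.2.1 _ hmem, radialEigenfunction_of_norm_eq_one hnorm] at h
  exact (mul_eq_zero.1 h.symm).resolve_left (hu.apply_zero_ne_zero hδ hμ)

end RadialEigenfunction

theorem lt_log_of_lt_one_div_exp_sub_one {δ c : ℝ} (hδ : 0 < δ) (hc : 0 < c)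
    (h : δ < 1 / (Real.exp c - 1)) : c < Real.log ((1 + δ) / δ) := by
  have hexp : 0 < Real.exp c - 1 := sub_pos.2 (Real.one_lt_exp_iff.2 hc)
  rw [Real.lt_log_iff_exp_lt (by positivity), lt_div_iff₀ hδ]
  rw [lt_div_iff₀ hexp] at h
  linarith

/-- For δ > 0, α = 1/log((1+δ)/δ) and the metric p(r,δ) = α/(r²+δ) on
    the unit disc, if δ < 1/(e^{(2m−1)π}−1) for a positive integer m, then the first
    m Dirichlet eigenvalues of the Laplace–Beltrami operator are simple and their
    eigenfunctions are S¹-invariant (radial): there are exactly m spectrum points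
    γ₀ < ⋯ < γ_{m−1} below the m-th one, each with a one-dimensional eigenspace
    consisting of radial functions. -/
theorem first_m_dirichlet_eigenvalues_simple_and_invariant
    (δ : ℝ) (hδ : 0 < δ) (m : ℕ) (hm : 1 ≤ m)
    (hδsmall : δ < 1 / (Real.exp ((2 * (m : ℝ) - 1) * Real.pi) - 1)) :
    ∃ γ : Fin m → ℝ, StrictMono γ ∧
      (∀ i, ∃ u, IsDirichletEigenfunction δ (γ i) u) ∧
      (∀ γ' : ℝ, (∃ u, IsDirichletEigenfunction δ γ' u) →
        γ' ≤ γ ⟨m - 1, by omega⟩ → ∃ i, γ' = γ i) ∧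
      (∀ i, ∀ u v, IsDirichletEigenfunction δ (γ i) u →
        IsDirichletEigenfunction δ (γ i) v →
        ∃ c : ℝ, ∀ x ∈ Metric.closedBall (0 : EuclideanSpace ℝ (Fin 2)) 1,
          v x = c * u x) ∧
      (∀ i, ∀ u, IsDirichletEigenfunction δ (γ i) u →
        ∀ x y : EuclideanSpace ℝ (Fin 2),
          x ∈ Metric.closedBall (0 : EuclideanSpace ℝ (Fin 2)) 1 →
          y ∈ Metric.closedBall (0 : EuclideanSpace ℝ (Fin 2)) 1 →
          ‖x‖ = ‖y‖ → u x = u y) := by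
  set L := Real.log ((1 + δ) / δ) with hL
  set c := (2 * (m : ℝ) - 1) * π with hc
  have hc0 : 0 < c := by
    have : (1 : ℝ) ≤ m := by exact_mod_cast hm
    have := Real.pi_pos
    exact mul_pos (by linarith) this
  have hcL : c < L := lt_log_of_lt_one_div_exp_sub_one hδ hc0 hδsmall
  have hL0 : 0 < L := hc0.trans hcL
  set b := c / (2 * L) with hb
  have hb0 : 0 < b := by positivity
  have hb1 : b < 1 / 2 := by
    rw [hb, div_lt_div_iff₀ (by positivity) two_pos]
    linarith
  have hbsq : b ^ 2 < 1 / 4 := by nlinarith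
  set ρ := 1 / (1 + δ) with hρ
  have hρ0 : 0 ≤ ρ := by positivity
  have hρ1 : ρ < 1 := by
    rw [hρ, div_lt_one (by positivity)]
    linarith
  have hlog : -Real.log (1 - ρ) = L := by
    rw [hL, ← Real.log_inv]
    have h1 : 1 - ρ = δ / (1 + δ) := by
      rw [hρ]
      field_simp
      ring
    rw [h1, inv_div]
  have hfin := finite_radialProfile_zeros (z := ρ) (b := b ^ 2)
    (by rwa [abs_of_nonneg hρ0]) (by linarith)
  have hcard : m ≤ hfin.toFinset.card := by
    refine le_card_radialProfile_zeros hρ0 hρ1 hb0.le (by linarith) ?_ hfin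
    rw [hlog, ← hc, hb]
    refine le_of_eq ?_
    field_simp
  set S := hfin.toFinset with hS
  have hSmem (lam : ℝ) : lam ∈ S ↔ (0 ≤ lam ∧ lam ≤ b ^ 2) ∧ radialProfile lam ρ = 0 := by
    rw [hS, Set.Finite.mem_toFinset]
    rfl
  set e : Fin m → ℝ := fun i => S.orderEmbOfFin rfl (Fin.castLE hcard i) with he
  have hemono : StrictMono e := fun i j hij => (S.orderEmbOfFin rfl).strictMono hij
  have hemem (i : Fin m) : (0 ≤ e i ∧ e i ≤ b ^ 2) ∧ radialProfile (e i) ρ = 0 :=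
    (hSmem _).1 (S.orderEmbOfFin_mem rfl _)
  have hquot (i : Fin m) : 4 * L * e i / L = 4 * e i := by field_simp
  have hlt (i : Fin m) : 4 * L * e i / L < 1 := by
    rw [hquot]
    linarith [(hemem i).1.2]
  refine ⟨fun i => 4 * L * e i, fun i j hij => ?_, fun i => ?_, fun γ' hγ' hle => ?_,
    fun i u v hu hv => ?_, fun i u hu x y hx _ hxy => hu.eq_of_norm_eq hδ (hlt i) hx hxy⟩
  · exact mul_lt_mul_of_pos_left (hemono hij) (by positivity)
  · refine ⟨_, isDirichletEigenfunction_radialEigenfunction hδ ?_ (hemem i).2 (hquot i)⟩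
    rw [abs_of_nonneg (hemem i).1.1]
    linarith [(hemem i).1.2]
  · obtain ⟨u, hu⟩ := hγ'
    set last : Fin m := ⟨m - 1, by omega⟩ with hlast
    have hμ : γ' / L ≤ 4 * e last := by
      rw [← hquot]
      exact div_le_div_of_nonneg_right hle hL0.le
    have hlam : γ' / L / 4 ≤ e last := by linarith
    have hmem : γ' / L / 4 ∈ S := (hSmem _).2
      ⟨⟨by linarith [hu.pos hδ], hlam.trans (hemem last).1.2⟩,
        hu.radialProfile_eq_zero hδ (by linarith [(hemem last).1.2])⟩
    rw [← Finset.mem_coe, ← S.range_orderEmbOfFin rfl] at hmem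
    obtain ⟨j, hj⟩ := hmem
    have hjle : j ≤ Fin.castLE hcard last := by
      rw [← (S.orderEmbOfFin rfl).le_iff_le, hj]
      exact hlam
    have hjm : (j : ℕ) < m := by
      have : (j : ℕ) ≤ m - 1 := hjle
      omega
    refine ⟨⟨j, hjm⟩, ?_⟩
    have hej : e ⟨j, hjm⟩ = γ' / L / 4 := hj
    simp only [hej]
    field_simp
  · refine ⟨v 0 / u 0, fun x hx => ?_⟩
    have hu0 := hu.apply_zero_ne_zero hδ (hlt i)
    rw [hu.eq_smul_radialEigenfunction hδ (hlt i) x hx,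
      hv.eq_smul_radialEigenfunction hδ (hlt i) x hx]
    field_simp
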